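/- arXiv:1507.02345 — 4 statements merged into one kernel-verified Lean document; each statement's English description precedes it below -/
import Mathlib

section
/- Let A, B ∈ ℂ satisfy A³ − 27B² ≠ 0, let J ⊂ ℝ be an open interval, and let u : J → ℂ be a continuously differentiable function with u'(x) ≠ 0 for all x ∈ J, satisfying the differential equation (u'(x))² = 4·u(x)³ − A·u(x) − B for all x ∈ J. Then there exist a lattice Λ ⊂ ℂ with g₂(Λ) = A and g₃(Λ) = B, and a constant α ∈ ℂ, such that x + α ∉ Λ and u(x) = ℘_Λ(x + α) for all x ∈ J. -/
open Set

/-- A lattice in `ℂ`: the set of integer combinations of two periods whose ratio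
is not real. -/
def IsLattice (Λ : Set ℂ) : Prop :=
  ∃ ω₁ ω₂ : ℂ, (ω₂ / ω₁).im ≠ 0 ∧
    Λ = {z : ℂ | ∃ m n : ℤ, z = (m : ℂ) * ω₁ + (n : ℂ) * ω₂}

/-- The Weierstrass ℘-function of the lattice `Λ`. -/
noncomputable def wp (Λ : Set ℂ) (z : ℂ) : ℂ :=
  1 / z ^ 2 + ∑' l : {l : ℂ // l ∈ Λ ∧ l ≠ 0}, (1 / (z - (l : ℂ)) ^ 2 - 1 / (l : ℂ) ^ 2)

/-- The Eisenstein invariant `g₂(Λ) = 60 Σ_{l ≠ 0} l⁻⁴`. -/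
noncomputable def g2 (Λ : Set ℂ) : ℂ :=
  60 * ∑' l : {l : ℂ // l ∈ Λ ∧ l ≠ 0}, ((l : ℂ) ^ 4)⁻¹

/-- The Eisenstein invariant `g₃(Λ) = 140 Σ_{l ≠ 0} l⁻⁶`. -/
noncomputable def g3 (Λ : Set ℂ) : ℂ :=
  140 * ∑' l : {l : ℂ // l ∈ Λ ∧ l ≠ 0}, ((l : ℂ) ^ 6)⁻¹

section
open UpperHalfPlane ModularForm SlashInvariantForm SlashInvariantFormClass ModularFormClass
  CuspFormClass MatrixGroups OnePoint Filter EisensteinSeries Asymptotics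
open scoped Topology

theorem tendsto_E_atImInfty {k : ℕ} (hk : 3 ≤ k) (hk2 : Even k) :
    Tendsto (fun τ : ℍ => E hk τ) atImInfty (𝓝 1) := by
  have h := E_qExpansion_coeff_zero hk hk2
  have hper := periodic_comp_ofComplex (E hk) one_mem_strictPeriods_SL
  have han : AnalyticAt ℂ (cuspFunction 1 (E hk)) 0 :=
    analyticAt_cuspFunction_zero one_pos hper (ModularFormClass.holo (E hk)) (ModularFormClass.bdd_at_infty (E hk))
  have h1 : cuspFunction 1 (E hk) 0 = 1 := by
    simpa [qExpansion_coeff] using h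
  have : (cuspFunction 1 (E hk) ∘ fun τ ↦ Function.Periodic.qParam 1 τ : ℍ → ℂ) = E hk := by
    funext τ
    simpa using eq_cuspFunction τ one_ne_zero hper
  rw [← h1]
  simpa [this] using han.continuousAt.tendsto.comp (qParam_tendsto_atImInfty one_pos)

theorem exists_E_rel (p q : ℂ) (hpq : p ≠ q) :
    ∃ τ : ℍ, p * E₄ τ ^ 3 = q * E₆ τ ^ 2 := by
  by_contra! hne
  let f : ModularForm 𝒮ℒ 12 :=
    p • ModularForm.mcast (by decide) (E₄.pow 3) - q • ModularForm.mcast (by decide) (E₆.pow 2)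
  have hf : ∀ z, f z = p * E₄ z ^ 3 - q * E₆ z ^ 2 := fun z => by
    have e4 : (E₄.pow 3) z = E₄ z ^ 3 := congrFun (ModularForm.coe_pow E₄ 3) z
    have e6 : (E₆.pow 2) z = E₆ z ^ 2 := congrFun (ModularForm.coe_pow E₆ 2) z
    rw [← e4, ← e6]
    simp [f]
  have hf0 : ∀ z, f z ≠ 0 := fun z => by rw [hf]; exact sub_ne_zero.mpr (hne z)
  have hlim : Tendsto (fun z => f z) atImInfty (𝓝 (p - q)) := by
    simp_rw [hf]
    have h4 := tendsto_E_atImInfty (k := 4) (by norm_num) ⟨2, rfl⟩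
    have h6 := tendsto_E_atImInfty (k := 6) (by norm_num) ⟨3, rfl⟩
    simpa using ((h4.pow 3).const_mul p).sub ((h6.pow 2).const_mul q)
  have hsl : ∀ γ : SL(2, ℤ), (fun z ↦ (1 : ModularForm 𝒮ℒ 0) z / f z) ∣[(0 : ℤ) - 12] γ = fun z ↦ (1 : ModularForm 𝒮ℒ 0) z / f z := by
    intro γ
    have hγ : (γ : GL (Fin 2) ℝ) ∈ 𝒮ℒ := ⟨γ, rfl⟩
    change (⇑(1 : ModularForm 𝒮ℒ 0) / ⇑f) ∣[(0 : ℤ) - 12] γ = ⇑(1 : ModularForm 𝒮ℒ 0) / ⇑f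
    simp_rw [div_slash_SL2, SL_slash, slash_action_eqn _ _ hγ]
  let g : ModularForm 𝒮ℒ (0 - 12) :=
    { toFun z := (1 : ModularForm 𝒮ℒ 0) z / f z
      slash_action_eq' := fun _ ⟨γ, hγ⟩ ↦ hγ ▸ hsl γ
      holo' := (1 : ModularForm 𝒮ℒ 0).holo'.div f.holo' hf0
      bdd_at_cusps' {c} hc := by
        rw [Subgroup.IsArithmetic.isCusp_iff_isCusp_SL2Z] at hc
        rw [isBoundedAt_iff_forall_SL2Z hc]
        intro γ _
        rw [hsl γ, IsBoundedAtImInfty, BoundedAtFilter]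
        have := (hlim.inv₀ (sub_ne_zero.mpr hpq)).isBigO_one ℝ
        refine this.congr (fun z => ?_) (fun _ => rfl)
        simp }
  have hg := levelOne_neg_weight_eq_zero (by norm_num) g
  have := congrFun hg I
  have h2 : g I = (f I)⁻¹ := by change (1 : ModularForm 𝒮ℒ 0) I / f I = _ ; simp
  rw [h2] at this
  exact hf0 I (by simpa using this)

theorem E_disc (z : ℍ) : E₄ z ^ 3 ≠ E₆ z ^ 2 := by
  intro h
  have := discriminant_eq_E₄_cube_sub_E₆_sq z
  rw [h] at this
  exact discriminant_ne_zero z (by simpa using this)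

theorem eis_tsum {k : ℕ} (hk : 3 ≤ k) (z : ℍ) :
    ∑' v : Fin 2 → ℤ, eisSummand k v z = 2 * riemannZeta k * E hk z := by
  rw [tsum_eisSummand_eq_riemannZeta_mul_eisensteinSeries hk z,
    show E hk z = (1 / 2 : ℂ) * eisensteinSeries (N := 1) 0 k z from rfl]
  ring

theorem zeta6 : riemannZeta 6 = Real.pi ^ 6 / 945 := by
  have := riemannZeta_two_mul_nat (k := 3) (by norm_num)
  norm_num [show bernoulli 6 = 1 / 42 by decide +kernel, Nat.factorial] at this
  rw [this]; ring
end

section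
open EisensteinSeries UpperHalfPlane ModularForm
theorem tsum_lat (Λ : Set ℂ) (L : PeriodPair) (h : Λ = L.lattice) (f : ℂ → ℂ) :
    ∑' l : {l : ℂ // l ∈ Λ ∧ l ≠ 0}, f l = ∑' l : L.lattice, if (l : ℂ) = 0 then 0 else f l := by
  have h1 := tsum_subtype {l : ℂ | l ∈ Λ ∧ l ≠ 0} f
  have h2 := tsum_subtype (L.lattice : Set ℂ) (fun l => if l = 0 then 0 else f l)
  refine h1.trans (Eq.trans ?_ h2.symm)
  congr 1
  ext l
  subst h
  by_cases h : l = 0 <;> by_cases h' : l ∈ L.lattice <;> simp [Set.indicator, h, h']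

theorem wp_eq (L : PeriodPair) (z : ℂ) : wp L.lattice z = L.weierstrassP z := by
  have h := L.weierstrassPExcept_add 0 z
  rw [wp, tsum_lat _ L rfl (fun l => 1 / (z - l) ^ 2 - 1 / l ^ 2), ← h]
  simp [PeriodPair.weierstrassPExcept]
  ring

theorem G_eq (L : PeriodPair) (n : ℕ) (hn : n ≠ 0) :
    ∑' l : {l : ℂ // l ∈ (L.lattice : Set ℂ) ∧ l ≠ 0}, ((l : ℂ) ^ n)⁻¹ = L.G n := by
  rw [tsum_lat _ L rfl (fun l => (l ^ n)⁻¹), PeriodPair.G]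
  congr 1
  ext l
  split_ifs with h <;> simp [h, hn]

theorem g2_eq (L : PeriodPair) : g2 L.lattice = L.g₂ := by
  rw [g2, G_eq L 4 (by norm_num), PeriodPair.g₂]

theorem g3_eq (L : PeriodPair) : g3 L.lattice = L.g₃ := by
  rw [g3, G_eq L 6 (by norm_num), PeriodPair.g₃]

noncomputable def latOf (c : ℂ) (hc : c ≠ 0) (τ : ℍ) : PeriodPair where
  ω₁ := c
  ω₂ := c * τ
  indep := by
    rw [LinearIndependent.pair_iff]
    intro s t h
    have h1 : (s : ℂ) + t * τ = 0 := by
      have : c * ((s : ℂ) + t * τ) = 0 := by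
        rw [← h]; simp; ring
      exact (mul_eq_zero.mp this).resolve_left hc
    have ht : t = 0 := by
      have := congrArg Complex.im h1
      simpa [τ.im_ne_zero] using this
    subst ht
    simpa using h1

theorem latOf_isLattice (c : ℂ) (hc : c ≠ 0) (τ : ℍ) : IsLattice (latOf c hc τ).lattice := by
  refine ⟨c, c * τ, ?_, ?_⟩
  · rw [mul_div_cancel_left₀ _ hc]; exact τ.im_ne_zero
  · ext z
    simp only [SetLike.mem_coe, PeriodPair.mem_lattice, latOf, Set.mem_ofPred_eq]
    simp only [eq_comm]

theorem latOf_G (c : ℂ) (hc : c ≠ 0) (τ : ℍ) (k : ℕ) :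
    (latOf c hc τ).G k = (c ^ k)⁻¹ * ∑' v : Fin 2 → ℤ, eisSummand k v τ := by
  rw [PeriodPair.G, ← (latOf c hc τ).latticeEquivProd.symm.toEquiv.tsum_eq,
    ← tsum_mul_left, ← ((finTwoArrowEquiv ℤ).trans (Equiv.prodComm ℤ ℤ)).tsum_eq]
  congr 1
  ext v
  have h : (((latOf c hc τ).latticeEquivProd.symm.toEquiv
      (((finTwoArrowEquiv ℤ).trans (Equiv.prodComm ℤ ℤ)) v) : (latOf c hc τ).lattice) : ℂ)
      = c * (v 0 * τ + v 1) := by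
    refine ((latOf c hc τ).latticeEquiv_symm_apply (v 1, v 0)).trans ?_
    simp [latOf]
    ring
  rw [h]
  simp [eisSummand, mul_pow, mul_comm]
end

section
open EisensteinSeries UpperHalfPlane ModularForm

theorem exists_scale (A B x y : ℂ) (hAB : A ^ 3 - 27 * B ^ 2 ≠ 0) (hrel : B ^ 2 * x ^ 3 = A ^ 3 * y ^ 2)
    (hxy : x ^ 3 ≠ 27 * y ^ 2) : ∃ c : ℂ, c ≠ 0 ∧ (c ^ 4)⁻¹ * x = A ∧ (c ^ 6)⁻¹ * y = B := by
  by_cases hA : A = 0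
  · subst hA
    have hB : B ≠ 0 := by rintro rfl; simp at hAB
    have hx : x = 0 := by simpa [hB] using hrel
    subst hx
    have hy : y ≠ 0 := by rintro rfl; simp at hxy
    obtain ⟨c, hc⟩ := IsAlgClosed.exists_pow_nat_eq (y / B) (n := 6) (by norm_num)
    refine ⟨c, ?_, by simp, ?_⟩
    · rintro rfl
      have : y / B ≠ 0 := div_ne_zero hy hB
      apply this; rw [← hc]; simp
    · rw [hc]; field_simp
  by_cases hB : B = 0
  · subst hB
    have hy : y = 0 := by simpa [hA] using hrel
    subst hy
    have hx : x ≠ 0 := by rintro rfl; simp at hxy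
    obtain ⟨c, hc⟩ := IsAlgClosed.exists_pow_nat_eq (x / A) (n := 4) (by norm_num)
    refine ⟨c, ?_, ?_, by simp⟩
    · rintro rfl
      have : x / A ≠ 0 := div_ne_zero hx hA
      apply this; rw [← hc]; simp
    · rw [hc]; field_simp
  have hx : x ≠ 0 := by
    rintro rfl
    have : y = 0 := by simpa [hA] using hrel
    subst this; simp at hxy
  have hy : y ≠ 0 := by
    rintro rfl
    have : x = 0 := by simpa [hB] using hrel
    exact hx this
  obtain ⟨c, hc⟩ := IsAlgClosed.exists_pow_nat_eq (y * A / (x * B)) (n := 2) (by norm_num)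
  have hcc : c ≠ 0 := by
    rintro rfl
    have : y * A / (x * B) ≠ 0 := div_ne_zero (mul_ne_zero hy hA) (mul_ne_zero hx hB)
    apply this; rw [← hc]; simp
  refine ⟨c, hcc, ?_, ?_⟩
  · rw [show c ^ 4 = (c ^ 2) ^ 2 by ring, hc]
    field_simp
    linear_combination hrel
  · rw [show c ^ 6 = (c ^ 2) ^ 3 by ring, hc]
    field_simp
    linear_combination hrel

theorem exists_lattice (A B : ℂ) (hAB : A ^ 3 - 27 * B ^ 2 ≠ 0) :
    ∃ L : PeriodPair, IsLattice L.lattice ∧ L.g₂ = A ∧ L.g₃ = B := by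
  have hpi : (Real.pi : ℂ) ≠ 0 := by exact_mod_cast Real.pi_ne_zero
  obtain ⟨τ, hτ⟩ := exists_E_rel (B ^ 2 * 27) (A ^ 3) (fun h => hAB (by rw [← h]; ring))
  have hd := E_disc τ
  obtain ⟨c, hc, h2, h3⟩ := exists_scale A B (4 * Real.pi ^ 4 / 3 * E₄ τ) (8 * Real.pi ^ 6 / 27 * E₆ τ) hAB
    (by linear_combination (64 * (Real.pi : ℂ) ^ 12 / 729) * hτ)
    (fun h => hd (by
      have h' : (64 * (Real.pi : ℂ) ^ 12 / 27) * (E₄ τ ^ 3 - E₆ τ ^ 2) = 0 := by linear_combination h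
      have : (64 * (Real.pi : ℂ) ^ 12 / 27) ≠ 0 := by simp
      exact sub_eq_zero.mp ((mul_eq_zero.mp h').resolve_left this)))
  refine ⟨latOf c hc τ, latOf_isLattice c hc τ, ?_, ?_⟩
  · have := eis_tsum (k := 4) (by norm_num) τ
    rw [PeriodPair.g₂, latOf_G, this, ← h2]
    push_cast
    rw [riemannZeta_four, E₄]
    ring
  · have := eis_tsum (k := 6) (by norm_num) τ
    rw [PeriodPair.g₃, latOf_G, this, ← h3]
    push_cast
    rw [zeta6, E₆]
    ring
end

section
open Filter Topology

theorem tendsto_wp (L : PeriodPair) (l : ℂ) (hl : l ∈ L.lattice) :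
    Tendsto (fun z => ‖L.weierstrassP z‖) (𝓝[≠] l) atTop := by
  have h := L.order_weierstrassP l hl
  have := (tendsto_cobounded_iff_meromorphicOrderAt_neg
    (L.meromorphic_weierstrassP l)).mpr (by rw [h]; decide)
  exact tendsto_norm_atTop_iff_cobounded.mpr this

theorem wp_surj (L : PeriodPair) (w : ℂ) : ∃ z, z ∉ L.lattice ∧ L.weierstrassP z = w := by
  by_contra! hne
  classical
  let h : ℂ → ℂ := fun z => if z ∈ L.lattice then 0 else (L.weierstrassP z - w)⁻¹
  have hnh : ∀ z ∉ L.lattice, (L.lattice : Set ℂ)ᶜ ∈ 𝓝 z := fun z hz =>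
    L.isClosed_lattice.isOpen_compl.mem_nhds hz
  have hd1 : ∀ z ∉ L.lattice, DifferentiableAt ℂ h z := by
    intro z hz
    have h1 : DifferentiableAt ℂ (fun z => (L.weierstrassP z - w)⁻¹) z :=
      (((L.differentiableOn_weierstrassP z hz).differentiableAt (hnh z hz)).sub_const w).inv
        (sub_ne_zero.mpr (hne z hz))
    refine h1.congr_of_eventuallyEq ?_
    filter_upwards [hnh z hz] with y hy
    exact if_neg hy
  have hd : Differentiable ℂ h := by
    intro z
    by_cases hz : z ∈ L.lattice
    swap
    · exact hd1 z hz
    have hev : ∀ᶠ y in 𝓝[≠] z, y ∉ L.lattice := by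
      have := L.compl_lattice_sdiff_singleton_mem_nhds z
      filter_upwards [mem_nhdsWithin_of_mem_nhds this, self_mem_nhdsWithin] with y hy hy'
      intro hyl
      exact hy ⟨hyl, hy'⟩
    refine (Complex.analyticAt_of_differentiable_on_punctured_nhds_of_continuousAt ?_ ?_).differentiableAt
    · filter_upwards [hev] with y hy using hd1 y hy
    · rw [continuousAt_iff_punctured_nhds]
      have h0 : h z = 0 := if_pos hz
      rw [h0]
      have ht : Tendsto (fun y => (L.weierstrassP y - w)⁻¹) (𝓝[≠] z) (𝓝 0) := by
        refine tendsto_inv₀_cobounded.comp ?_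
        rw [← tendsto_norm_atTop_iff_cobounded]
        refine tendsto_atTop_mono (fun y => ?_) (tendsto_atTop_add_const_right _ (-‖w‖) (tendsto_wp L z hz))
        have := norm_sub_norm_le (L.weierstrassP y) w
        linarith
      refine ht.congr' ?_
      filter_upwards [hev] with y hy
      exact (if_neg hy).symm
  have hper : ∀ z, ∀ l ∈ L.lattice, h (z + l) = h z := by
    intro z l hl
    have : L.weierstrassP (z + l) = L.weierstrassP z := L.weierstrassP_add_coe z ⟨l, hl⟩
    simp only [h, this, Submodule.add_mem_iff_left _ hl]
  have hb : Bornology.IsBounded (Set.range h) :=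
    (IsZLattice.isCompact_range_of_periodic L.lattice h hd.continuous
      (fun z w hw => hper z w hw)).isBounded
  have := hd.apply_eq_apply_of_bounded hb 0 (L.ω₁ / 2)
  simp only [h] at this
  rw [if_pos (zero_mem _), if_neg L.ω₁_div_two_notMem_lattice] at this
  exact sub_ne_zero.mpr (hne _ L.ω₁_div_two_notMem_lattice) (inv_eq_zero.mp this.symm)
end

section
open Filter Topology

theorem local_unique (A B : ℂ) (f f' g g' : ℝ → ℂ) (x : ℝ)
    (hf : ∀ᶠ t in 𝓝 x, HasDerivAt f (f' t) t) (hg : ∀ᶠ t in 𝓝 x, HasDerivAt g (g' t) t)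
    (hfc : ContinuousAt f' x) (hgc : ContinuousAt g' x)
    (hfo : ∀ᶠ t in 𝓝 x, f' t ^ 2 = 4 * f t ^ 3 - A * f t - B)
    (hgo : ∀ᶠ t in 𝓝 x, g' t ^ 2 = 4 * g t ^ 3 - A * g t - B)
    (h0 : f x = g x) (h0' : f' x = g' x) (hne : f' x ≠ 0) :
    f =ᶠ[𝓝 x] g ∧ f' =ᶠ[𝓝 x] g' := by
  set y := f' x with hy
  let F : ℂ → ℂ := fun w => y * ((4 * w ^ 3 - A * w - B) / y ^ 2) ^ (2⁻¹ : ℂ)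
  have key : ∀ (k k' : ℝ → ℂ), ContinuousAt k' x → k' x = y →
      (∀ᶠ t in 𝓝 x, k' t ^ 2 = 4 * k t ^ 3 - A * k t - B) →
      ∀ᶠ t in 𝓝 x, k' t = F (k t) := by
    intro k k' hc hk ho
    have h1 : ContinuousAt (fun t => (k' t / y).re) x :=
      Complex.continuous_re.continuousAt.comp (hc.div_const y)
    have h2 : ∀ᶠ t in 𝓝 x, 0 < (k' t / y).re := by
      refine h1.eventually (lt_mem_nhds ?_)
      beta_reduce
      rw [hk, div_self hne]; simp
    filter_upwards [h2, ho] with t ht hot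
    simp only [F]
    rw [← hot, ← div_pow, Complex.sq_cpow_two_inv ht]
    field_simp
  have hF : ContDiffAt ℝ 1 F (f x) := by
    have hd : ∀ᶠ w in 𝓝 (f x), DifferentiableAt ℂ F w := by
      have hv : (4 * f x ^ 3 - A * f x - B) / y ^ 2 = 1 := by
        rw [← hfo.self_of_nhds]; exact div_self (pow_ne_zero 2 hne)
      have hc : ContinuousAt (fun w : ℂ => (4 * w ^ 3 - A * w - B) / y ^ 2) (f x) := by fun_prop
      have hs : ∀ᶠ w in 𝓝 (f x), (4 * w ^ 3 - A * w - B) / y ^ 2 ∈ Complex.slitPlane := by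
        refine hc.eventually (Complex.isOpen_slitPlane.mem_nhds ?_)
        beta_reduce
        rw [hv]; exact Complex.one_mem_slitPlane
      filter_upwards [hs] with w hw
      refine DifferentiableAt.const_mul ?_ _
      exact DifferentiableAt.cpow (by fun_prop) (by fun_prop) hw
    have : AnalyticAt ℂ F (f x) := Complex.analyticAt_iff_eventually_differentiableAt.mpr hd
    exact this.contDiffAt.restrict_scalars ℝ
  obtain ⟨K, s, hs, hK⟩ := hF.exists_lipschitzOnWith
  have hfF := key f f' hfc rfl hfo
  have hgF := key g g' hgc h0'.symm hgo
  have hfs : ∀ᶠ t in 𝓝 x, f t ∈ s := hf.self_of_nhds.continuousAt.eventually hs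
  have hgs : ∀ᶠ t in 𝓝 x, g t ∈ s := hg.self_of_nhds.continuousAt.eventually (h0 ▸ hs)
  have e : f =ᶠ[𝓝 x] g := by
    refine ODE_solution_unique_of_eventually (v := fun _ => F) (s := fun _ => s) (K := K)
      (Eventually.of_forall fun _ => hK) ?_ ?_ h0
    · filter_upwards [hf, hfF, hfs] with t h1 h2 h3
      exact ⟨h2 ▸ h1, h3⟩
    · filter_upwards [hg, hgF, hgs] with t h1 h2 h3
      exact ⟨h2 ▸ h1, h3⟩
  refine ⟨e, ?_⟩
  filter_upwards [e, hfF, hgF] with t h1 h2 h3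
  rw [h2, h3, h1]

theorem main_aux (L : PeriodPair) (a b : ℝ) (hab : a < b) (u u' : ℝ → ℂ)
    (hderiv : ∀ x ∈ Ioo a b, HasDerivAt u (u' x) x)
    (hcont : ContinuousOn u' (Ioo a b))
    (hne : ∀ x ∈ Ioo a b, u' x ≠ 0)
    (hode : ∀ x ∈ Ioo a b, (u' x) ^ 2 = 4 * (u x) ^ 3 - L.g₂ * u x - L.g₃) :
    ∃ α : ℂ, ∀ x ∈ Ioo a b, ((x : ℂ) + α ∉ L.lattice) ∧ u x = L.weierstrassP ((x : ℂ) + α) := by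
  obtain ⟨x₀, hx₀⟩ : (Ioo a b).Nonempty := nonempty_Ioo.mpr hab
  obtain ⟨z₀, hz₀, hu, hu'⟩ : ∃ z, z ∉ L.lattice ∧ L.weierstrassP z = u x₀ ∧
      L.derivWeierstrassP z = u' x₀ := by
    obtain ⟨z, hz, hzu⟩ := wp_surj L (u x₀)
    have h1 := L.derivWeierstrassP_sq z hz
    rw [hzu, ← hode x₀ hx₀] at h1
    rcases sq_eq_sq_iff_eq_or_eq_neg.mp h1 with h | h
    · exact ⟨z, hz, hzu, h⟩
    · exact ⟨-z, by simpa using hz, by rw [L.weierstrassP_neg, hzu],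
        by rw [L.derivWeierstrassP_neg, h, neg_neg]⟩
  set α := z₀ - x₀ with hα
  have hlin : ∀ x : ℝ, HasDerivAt (fun t : ℝ => (t : ℂ) + α) 1 x := fun x =>
    (Complex.ofRealCLM.hasDerivAt (x := x)).add_const α
  have hcl : Continuous (fun t : ℝ => (t : ℂ) + α) := by fun_prop
  have hev : ∀ x : ℝ, (x : ℂ) + α ∉ L.lattice → ∀ᶠ t : ℝ in 𝓝 x, (t : ℂ) + α ∉ L.lattice :=
    fun x hx => hcl.continuousAt.eventually (L.isClosed_lattice.isOpen_compl.mem_nhds hx)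
  have hwd : ∀ x : ℝ, (x : ℂ) + α ∉ L.lattice →
      HasDerivAt (fun t : ℝ => L.weierstrassP ((t : ℂ) + α)) (L.derivWeierstrassP ((x : ℂ) + α)) x := by
    intro x hx
    have h1 : DifferentiableAt ℂ L.weierstrassP ((x : ℂ) + α) :=
      (L.analyticOnNhd_weierstrassP _ hx).differentiableAt
    have h2 := h1.hasDerivAt
    rw [L.deriv_weierstrassP] at h2
    have h3 := HasDerivAt.comp x h2 (hlin x)
    rw [mul_one] at h3
    exact h3
  have hwc : ∀ x : ℝ, (x : ℂ) + α ∉ L.lattice →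
      ContinuousAt (fun t : ℝ => L.derivWeierstrassP ((t : ℂ) + α)) x := by
    intro x hx
    have h1 : ContinuousAt L.derivWeierstrassP ((x : ℂ) + α) :=
      (L.analyticOnNhd_derivWeierstrassP _ hx).continuousAt
    exact ContinuousAt.comp (f := fun t : ℝ => (t : ℂ) + α) h1 hcl.continuousAt
  have hI : ∀ x ∈ Ioo a b, Ioo a b ∈ 𝓝 x := fun x hx => isOpen_Ioo.mem_nhds hx
  let S : Set ℝ := {x | x ∈ Ioo a b ∧ (x : ℂ) + α ∉ L.lattice ∧
    u x = L.weierstrassP ((x : ℂ) + α) ∧ u' x = L.derivWeierstrassP ((x : ℂ) + α)}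
  have hSo : IsOpen S := by
    rw [isOpen_iff_mem_nhds]
    rintro x ⟨hx, hxl, h1, h2⟩
    have hxI := hI x hx
    have hl := hev x hxl
    obtain ⟨e1, e2⟩ := local_unique L.g₂ L.g₃ u u' (fun t : ℝ => L.weierstrassP ((t : ℂ) + α))
      (fun t : ℝ => L.derivWeierstrassP ((t : ℂ) + α)) x
      (by filter_upwards [hxI] with t ht using hderiv t ht)
      (by filter_upwards [hl] with t ht using hwd t ht)
      (hcont.continuousAt hxI) (hwc x hxl)
      (by filter_upwards [hxI] with t ht using hode t ht)
      (by filter_upwards [hl] with t ht using L.derivWeierstrassP_sq _ ht)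
      h1 h2 (hne x hx)
    filter_upwards [hxI, hl, e1, e2] with t h1 h2 h3 h4
    exact ⟨h1, h2, h3, h4⟩
  have hsub : Ioo a b ⊆ S := by
    refine isPreconnected_Ioo.subset_of_closure_inter_subset hSo ⟨x₀, hx₀, hx₀, ?_⟩ ?_
    · have : (x₀ : ℂ) + α = z₀ := by rw [hα]; ring
      rw [this]
      exact ⟨hz₀, hu.symm, hu'.symm⟩
    rintro x ⟨hxc, hx⟩
    have hfr : ∃ᶠ t in 𝓝 x, t ∈ S := mem_closure_iff_frequently.mp hxc
    have huc := (hderiv x hx).continuousAt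
    by_cases hxS : x ∈ S
    · exact hxS
    have hxl : (x : ℂ) + α ∉ L.lattice := by
      intro hxl
      have ht : Tendsto (fun t : ℝ => (t : ℂ) + α) (𝓝[≠] x) (𝓝[≠] ((x : ℂ) + α)) := by
        refine tendsto_nhdsWithin_iff.mpr ⟨hcl.continuousAt.tendsto.mono_left nhdsWithin_le_nhds, ?_⟩
        filter_upwards [self_mem_nhdsWithin] with t ht h
        exact ht (by simpa using h)
      have h1 := ((tendsto_wp L _ hxl).comp ht).eventually_gt_atTop (‖u x‖ + 1)
      rw [eventually_nhdsWithin_iff] at h1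
      have h2 : ∀ᶠ t in 𝓝 x, ‖u t‖ < ‖u x‖ + 1 :=
        huc.norm.eventually (gt_mem_nhds (by linarith))
      obtain ⟨t, htS, ht1, ht2⟩ := (hfr.and_eventually (h1.and h2)).exists
      have hne' : t ∈ ({x} : Set ℝ)ᶜ := by rintro rfl; exact hxS htS
      have := ht1 hne'
      simp only [Function.comp] at this
      rw [← htS.2.2.1] at this
      linarith
    have c1 := (hwd x hxl).continuousAt
    have c2 := hwc x hxl
    have c3 := hcont.continuousAt (hI x hx)
    refine ⟨hx, hxl, ?_, ?_⟩
    · by_contra h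
      obtain ⟨t, h1, h2⟩ := (hfr.and_eventually ((huc.sub c1).eventually_ne (sub_ne_zero.mpr h))).exists
      exact h2 (sub_eq_zero.mpr h1.2.2.1)
    · by_contra h
      obtain ⟨t, h1, h2⟩ := (hfr.and_eventually ((c3.sub c2).eventually_ne (sub_ne_zero.mpr h))).exists
      exact h2 (sub_eq_zero.mpr h1.2.2.2)
  exact ⟨α, fun x hx => ⟨(hsub hx).2.1, (hsub hx).2.2.1⟩⟩
end

/-- A `C¹` complex-valued function on an open real interval with nonvanishing derivative
satisfying `(u')² = 4u³ − Au − B` (with `A³ − 27B² ≠ 0`) is a translate of a Weierstrass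
℘-function with invariants `g₂ = A`, `g₃ = B`. -/
theorem weierstrass_representation
    (A B : ℂ) (hAB : A ^ 3 - 27 * B ^ 2 ≠ 0)
    (a b : ℝ) (hab : a < b)
    (u u' : ℝ → ℂ)
    (hderiv : ∀ x ∈ Ioo a b, HasDerivAt u (u' x) x)
    (hcont : ContinuousOn u' (Ioo a b))
    (hne : ∀ x ∈ Ioo a b, u' x ≠ 0)
    (hode : ∀ x ∈ Ioo a b, (u' x) ^ 2 = 4 * (u x) ^ 3 - A * u x - B) :
    ∃ Λ : Set ℂ, IsLattice Λ ∧ g2 Λ = A ∧ g3 Λ = B ∧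
      ∃ α : ℂ, ∀ x ∈ Ioo a b, ((x : ℂ) + α ∉ Λ) ∧ u x = wp Λ ((x : ℂ) + α) := by
  obtain ⟨L, hL, rfl, rfl⟩ := exists_lattice A B hAB
  obtain ⟨α, hα⟩ := main_aux L a b hab u u' hderiv hcont hne hode
  refine ⟨L.lattice, hL, g2_eq L, g3_eq L, α, fun x hx => ⟨(hα x hx).1, ?_⟩⟩
  rw [wp_eq]
  exact (hα x hx).2
end

section
/- A lattice Λ ⊂ ℂ satisfies g₂(Λ) = 0 and g₃(Λ) ≠ 0 if and only if Λ = {m·ω + n·ω·e^{iπ/3} : m, n ∈ ℤ} for some nonzero ω ∈ ℂ. Moreover, g₃(Λ) < 0 (i.e., the Weierstrass function satisfies (℘_Λ')² = 4℘_Λ³ + C with C > 0) if and only if Λ has this form with ω = |ω|·e^{iπ/6}. In that case: ℘_Λ takes only real values on ℝ ∖ Λ; its real poles are exactly the integer multiples of √3·|ω|; its only zeros in a fundamental parallelogram are at √3·|ω|/3 and 2√3·|ω|/3; and ℘_Λ is strictly increasing on the real interval (2√3·|ω|/3, √3·|ω|). -/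
open Set

/-- The hexagonal lattice generated by `ω` and `ω e^{iπ/3}`. -/
noncomputable def hexLattice (ω : ℂ) : Set ℂ :=
  {z : ℂ | ∃ m n : ℤ, z = (m : ℂ) * ω + (n : ℂ) * (ω * Complex.exp ((Real.pi : ℂ) * Complex.I / 3))}

open Filter Topology

lemma aux_exists_pair {Λ : Set ℂ} (hΛ : IsLattice Λ) :
    ∃ L : PeriodPair, Λ = (L.lattice : Set ℂ) := by
  obtain ⟨a, b, hab, rfl⟩ := hΛ
  have ha : a ≠ 0 := by rintro rfl; simp at hab
  refine ⟨⟨a, b, ?_⟩, ?_⟩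
  · rw [LinearIndependent.pair_iff]
    intro s t h
    have ht : t = 0 := by
      have h1 : (s : ℂ) + t * (b / a) = 0 := by
        have : (s : ℂ) * a + t * b = 0 := by simpa using h
        field_simp
        linear_combination this
      have h2 := congrArg Complex.im h1
      simp only [Complex.add_im, Complex.ofReal_im, Complex.im_ofReal_mul, zero_add,
        Complex.zero_im, mul_eq_zero] at h2
      tauto
    subst ht
    have : (s : ℂ) * a = 0 := by simpa using h
    simpa [ha] using this
  · ext z
    simp only [Set.mem_ofPred_eq, SetLike.mem_coe, PeriodPair.mem_lattice]
    constructor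
    · rintro ⟨m, n, rfl⟩; exact ⟨m, n, rfl⟩
    · rintro ⟨m, n, rfl⟩; exact ⟨m, n, rfl⟩

lemma aux_tsum (L : PeriodPair) (f : ℂ → ℂ) (h0 : f 0 = 0) :
    ∑' l : {l : ℂ // l ∈ (L.lattice : Set ℂ) ∧ l ≠ 0}, f l = ∑' l : L.lattice, f l := by
  have h1 := tsum_subtype {l : ℂ | l ∈ (L.lattice : Set ℂ) ∧ l ≠ 0} f
  have h2 := tsum_subtype (L.lattice : Set ℂ) f
  refine h1.trans (Eq.trans ?_ h2.symm)
  congr 1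
  ext x
  by_cases hx : x = 0
  · subst hx; simp [Set.indicator, h0]
  · simp only [Set.indicator, Set.mem_ofPred_eq]
    split_ifs <;> tauto

lemma aux_g2 (L : PeriodPair) : g2 (L.lattice : Set ℂ) = L.g₂ := by
  unfold g2 PeriodPair.g₂ PeriodPair.G
  rw [aux_tsum L (fun l => (l ^ 4)⁻¹) (by simp)]

lemma aux_g3 (L : PeriodPair) : g3 (L.lattice : Set ℂ) = L.g₃ := by
  unfold g3 PeriodPair.g₃ PeriodPair.G
  rw [aux_tsum L (fun l => (l ^ 6)⁻¹) (by simp)]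

lemma aux_P_split (L : PeriodPair) (z : ℂ) :
    L.weierstrassP z = L.weierstrassPExcept 0 z + 1 / z ^ 2 := by
  have := L.weierstrassPExcept_add 0 z
  simp at this
  simp [← this]

lemma aux_wp (L : PeriodPair) (z : ℂ) : wp (L.lattice : Set ℂ) z = L.weierstrassP z := by
  rw [aux_P_split, add_comm]
  unfold wp PeriodPair.weierstrassPExcept
  congr 1
  rw [← aux_tsum L (fun l => if l = 0 then 0 else (1 / (z - l) ^ 2 - 1 / l ^ 2)) (by simp)]
  congr 1
  ext l
  simp [l.2.2]

lemma aux_uniqueM {A B D : ℂ → ℂ} (hA : ContinuousAt A 0) (hB : ContinuousAt B 0)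
    (hD : AnalyticAt ℂ D 0)
    (h : ∀ᶠ z in 𝓝[≠] (0 : ℂ), z * A z * deriv D z = B z * D z)
    (hN : ∀ N : ℕ, (N = 0 → D 0 ≠ 0) → (N : ℂ) * A 0 ≠ B 0) :
    ∀ᶠ z in 𝓝 (0 : ℂ), D z = 0 := by
  by_contra hcon
  obtain ⟨n, g, hg, hg0, hgD⟩ := hD.exists_eventuallyEq_pow_smul_nonzero_iff.mpr hcon
  simp only [sub_zero, smul_eq_mul] at hgD
  refine hN n ?_ ?_
  · rintro rfl
    have := hgD.self_of_nhds
    simpa [this] using hg0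
  · have key : ∀ᶠ z in 𝓝[≠] (0 : ℂ), A z * (n * g z + z * deriv g z) = B z * g z := by
      have hd : ∀ᶠ z in 𝓝 (0 : ℂ), deriv D z = n * z ^ (n - 1) * g z + z ^ n * deriv g z := by
        have h1 : ∀ᶠ z in 𝓝 (0 : ℂ), D =ᶠ[𝓝 z] fun z => z ^ n * g z :=
          Filter.Eventually.eventually_nhds hgD
        filter_upwards [h1, hg.eventually_analyticAt] with z hz hgz
        rw [hz.deriv_eq, deriv_fun_mul (by fun_prop) hgz.differentiableAt]
        simp
      filter_upwards [h, nhdsWithin_le_nhds hd, nhdsWithin_le_nhds hgD, self_mem_nhdsWithin]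
        with z h1 h2 h3 h4
      have hz : z ≠ 0 := h4
      rw [h2, h3] at h1
      have hzn : z ^ n ≠ 0 := pow_ne_zero _ hz
      apply mul_left_cancel₀ hzn
      rcases n with _ | n
      · simp at h1 ⊢
        linear_combination h1
      · simp only [Nat.add_sub_cancel] at h1
        linear_combination h1
    have hc1 : ContinuousAt (fun z => A z * (n * g z + z * deriv g z)) 0 := by
      have := hg.continuousAt
      have := hg.deriv.continuousAt
      fun_prop
    have hc2 : ContinuousAt (fun z => B z * g z) 0 := hB.mul hg.continuousAt
    have t1 := hc1.tendsto.mono_left (nhdsWithin_le_nhds (s := {0}ᶜ))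
    have t2 := hc2.tendsto.mono_left (nhdsWithin_le_nhds (s := {0}ᶜ))
    have := tendsto_nhds_unique (t1.congr' key) t2
    simp only [zero_mul, add_zero] at this
    apply mul_right_cancel₀ hg0
    linear_combination this

lemma aux_uniqueK {P Q : ℂ → ℂ} (hP : AnalyticAt ℂ P 0) (hQ : AnalyticAt ℂ Q 0)
    (h : ∀ᶠ z in 𝓝[≠] (0 : ℂ), (deriv P z - 2 / z ^ 3) ^ 2 - 4 * (P z + 1 / z ^ 2) ^ 3 =
      (deriv Q z - 2 / z ^ 3) ^ 2 - 4 * (Q z + 1 / z ^ 2) ^ 3) :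
    ∀ᶠ z in 𝓝 (0 : ℂ), P z = Q z := by
  have hm := aux_uniqueM (A := fun z => z ^ 3 * (deriv P z + deriv Q z) - 4)
    (B := fun z => 4 * ((z ^ 2 * P z + 1) ^ 2 + (z ^ 2 * P z + 1) * (z ^ 2 * Q z + 1)
      + (z ^ 2 * Q z + 1) ^ 2)) (D := fun z => P z - Q z)
    (by have := hP.deriv.continuousAt; have := hQ.deriv.continuousAt; fun_prop)
    (by have := hP.continuousAt; have := hQ.continuousAt; fun_prop) (hP.sub hQ) ?_ ?_
  · filter_upwards [hm] with z hz
    exact sub_eq_zero.mp hz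
  · filter_upwards [h, self_mem_nhdsWithin, nhdsWithin_le_nhds hP.eventually_analyticAt,
      nhdsWithin_le_nhds hQ.eventually_analyticAt] with z h1 h2 h3 h4
    have hz : z ≠ 0 := h2
    rw [deriv_fun_sub h3.differentiableAt h4.differentiableAt]
    generalize deriv P z = p at *
    generalize deriv Q z = q at *
    generalize P z = P at *
    generalize Q z = Q at *
    have e : z * (z ^ 3 * (p + q) - 4) * (p - q) -
      4 * ((z ^ 2 * P + 1) ^ 2 + (z ^ 2 * P + 1) * (z ^ 2 * Q + 1)
      + (z ^ 2 * Q + 1) ^ 2) * (P - Q) = z ^ 4 *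
      (((p - 2 / z ^ 3) ^ 2 - 4 * (P + 1 / z ^ 2) ^ 3) -
      ((q - 2 / z ^ 3) ^ 2 - 4 * (Q + 1 / z ^ 2) ^ 3)) := by
      field_simp
      ring
    rw [h1, sub_self, mul_zero] at e
    exact sub_eq_zero.mp e
  · intro N _ hN
    norm_num at hN
    have h2 : ((N + 3 : ℕ) : ℂ) = 0 := by push_cast; linear_combination (-1/4 : ℂ) * hN
    norm_cast at h2

lemma aux_pole (L : PeriodPair) {h : ℂ → ℂ} (hm : Meromorphic h) {x : ℂ}
    (hx : ∀ᶠ z in 𝓝[≠] x, L.weierstrassP z = h z) {l : ℂ} (hl : l ∈ L.lattice) :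
    ¬ AnalyticAt ℂ h l := by
  intro hA
  have hD : Meromorphic (L.weierstrassP - h) := L.meromorphic_weierstrassP.sub hm
  have hx' : meromorphicOrderAt (L.weierstrassP - h) x = ⊤ := by
    rw [meromorphicOrderAt_eq_top_iff]
    filter_upwards [hx] with z hz
    simp [hz]
  have hl' : meromorphicOrderAt (L.weierstrassP - h) l = ⊤ := by
    by_contra hne
    exact (hD.exists_meromorphicOrderAt_ne_top_iff_forall.mp ⟨l, hne⟩) x hx'
  rw [meromorphicOrderAt_eq_top_iff] at hl'
  have h1 : L.weierstrassP =ᶠ[𝓝[≠] l] h := by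
    filter_upwards [hl'] with z hz
    exact sub_eq_zero.mp hz
  have h2 := meromorphicOrderAt_congr h1
  rw [L.order_weierstrassP l hl] at h2
  have h3 := hA.meromorphicOrderAt_nonneg
  rw [← h2] at h3
  exact absurd h3 (by decide)

lemma aux_pole_affine (L : PeriodPair) (c a b : ℂ) {x : ℂ}
    (hx : ∀ᶠ z in 𝓝[≠] x, L.weierstrassP z = c * L.weierstrassP (a * z + b)) {l : ℂ}
    (hl : l ∈ L.lattice) : a * l + b ∈ L.lattice := by
  by_contra hn
  refine aux_pole L (h := fun z => c * L.weierstrassP (a * z + b)) ?_ hx hl ?_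
  · intro y
    have := (L.meromorphic_weierstrassP (a * y + b)).comp_analyticAt
      (g := fun z => a * z + b) (x := y) (by fun_prop)
    exact (MeromorphicAt.const c y).mul this
  · have := (L.analyticOnNhd_weierstrassP (a * l + b) hn).comp
      (f := fun z => a * z + b) (x := l) (by fun_prop)
    exact analyticAt_const.mul this

lemma aux_near (L : PeriodPair) : ∀ᶠ z in 𝓝[≠] (0 : ℂ), z ∉ L.lattice := by
  filter_upwards [nhdsWithin_le_nhds (L.compl_lattice_sdiff_singleton_mem_nhds 0),
    self_mem_nhdsWithin] with z h1 h2 h3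
  exact h1 ⟨h3, h2⟩

/-- derivative of the regular part near zero -/
lemma aux_deriv_P (L : PeriodPair) {z : ℂ} (hz : z ∉ L.lattice) :
    deriv (L.weierstrassPExcept 0) z - 2 / z ^ 3 = L.derivWeierstrassP z := by
  have hz' : z ∈ ((L.lattice : Set ℂ) \ {0})ᶜ := fun h => hz h.1
  rw [L.eqOn_deriv_weierstrassPExcept_derivWeierstrassPExcept 0 hz']
  have := L.derivWeierstrassPExcept_sub 0 z
  simpa using this

lemma aux_g3_ne (L : PeriodPair) (h2 : L.g₂ = 0) : L.g₃ ≠ 0 := by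
  intro h3
  have hk := aux_uniqueK (P := L.weierstrassPExcept 0) (Q := fun _ => 0)
    (L.analyticAt_weierstrassPExcept 0) analyticAt_const ?_
  · have hx : ∀ᶠ z in 𝓝[≠] (0 : ℂ), L.weierstrassP z = 1 / z ^ 2 := by
      filter_upwards [nhdsWithin_le_nhds hk] with z hz
      rw [aux_P_split, hz, zero_add]
    have hne : L.ω₁ ≠ 0 := by
      intro h0
      exact L.ω₁_div_two_notMem_lattice (by rw [h0]; simp)
    refine aux_pole L (h := fun z => 1 / z ^ 2) ?_ hx L.ω₁_mem_lattice ?_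
    · intro y; fun_prop
    · apply AnalyticAt.div (by fun_prop) (by fun_prop); exact pow_ne_zero _ hne
  · filter_upwards [aux_near L, self_mem_nhdsWithin] with z hz hz0
    have hz0 : z ≠ 0 := hz0
    rw [aux_deriv_P L hz, ← aux_P_split, L.derivWeierstrassP_sq z hz, h2, h3]
    simp
    field_simp
    norm_num

/-- the sixth root of unity -/
noncomputable def aρ : ℂ := Complex.exp ((Real.pi : ℂ) * Complex.I / 3)

lemma aρ_prim : IsPrimitiveRoot aρ 6 := by
  have := Complex.isPrimitiveRoot_exp 6 (by norm_num)
  convert this using 1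
  unfold aρ
  congr 1
  push_cast
  ring

lemma aρ_six : aρ ^ 6 = 1 := aρ_prim.pow_eq_one
lemma aρ_ne : aρ ≠ 0 := Complex.exp_ne_zero _

lemma aρ_val : aρ = ⟨1 / 2, Real.sqrt 3 / 2⟩ := by
  unfold aρ
  rw [show (Real.pi : ℂ) * Complex.I / 3 = ((Real.pi / 3 : ℝ) : ℂ) * Complex.I by push_cast; ring]
  apply Complex.ext
  · rw [Complex.exp_ofReal_mul_I_re, Real.cos_pi_div_three]
  · rw [Complex.exp_ofReal_mul_I_im, Real.sin_pi_div_three]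

lemma aρ_sq : aρ ^ 2 = aρ - 1 := by
  have h3 : Real.sqrt 3 ^ 2 = 3 := Real.sq_sqrt (by norm_num)
  rw [aρ_val, sq]
  apply Complex.ext <;> simp <;> nlinarith

lemma aux_rot (L : PeriodPair) (h2 : L.g₂ = 0) {l : ℂ} (hl : l ∈ L.lattice) :
    aρ * l ∈ L.lattice := by
  have h0 : L.weierstrassPExcept 0 = L.weierstrassPExcept 0 := rfl
  have hP := L.analyticAt_weierstrassPExcept 0
  have hcomp : AnalyticAt ℂ (fun z => L.weierstrassPExcept 0 (aρ * z)) 0 := by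
    have : AnalyticAt ℂ (L.weierstrassPExcept 0) (aρ * 0) := by simpa using hP
    exact this.comp (f := fun z => aρ * z) (by fun_prop)
  have hnear2 : ∀ᶠ z in 𝓝[≠] (0 : ℂ), aρ * z ∉ L.lattice := by
    have : Tendsto (fun z : ℂ => aρ * z) (𝓝[≠] 0) (𝓝[≠] 0) := by
      apply tendsto_nhdsWithin_of_tendsto_nhds_of_eventually_within
      · have : Continuous fun z : ℂ => aρ * z := by fun_prop
        simpa using (this.tendsto 0).mono_left nhdsWithin_le_nhds
      · filter_upwards [self_mem_nhdsWithin] with z hz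
        exact mul_ne_zero aρ_ne hz
    exact this.eventually (aux_near L)
  have hk := aux_uniqueK (P := L.weierstrassPExcept 0)
    (Q := fun z => aρ ^ 2 * L.weierstrassPExcept 0 (aρ * z)) hP
    (analyticAt_const.mul hcomp) ?_
  · have := aux_pole_affine L (aρ ^ 2) aρ 0 (x := 0) ?_ hl
    · simpa using this
    · filter_upwards [nhdsWithin_le_nhds hk, self_mem_nhdsWithin] with z hz hz0
      have hz0 : z ≠ 0 := hz0
      have := aρ_ne
      rw [aux_P_split, aux_P_split, hz, add_zero]
      field_simp
  · filter_upwards [aux_near L, self_mem_nhdsWithin, hnear2] with z hz hz0 hz2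
    have hz0 : z ≠ 0 := hz0
    have hne := aρ_ne
    have hd : DifferentiableAt ℂ (L.weierstrassPExcept 0) (aρ * z) :=
      (L.analyticOnNhd_weierstrassPExcept 0 (aρ * z) (fun h => hz2 h.1)).differentiableAt
    have hder : deriv (fun z => aρ ^ 2 * L.weierstrassPExcept 0 (aρ * z)) z =
        aρ ^ 3 * deriv (L.weierstrassPExcept 0) (aρ * z) := by
      have h1 : HasDerivAt (fun z : ℂ => aρ * z) aρ z := by
        simpa using (hasDerivAt_id z).const_mul aρ
      have h2 := (hd.hasDerivAt.comp z h1).const_mul (aρ ^ 2)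
      have h3 := h2.deriv
      simp only [Function.comp_def] at h3
      rw [h3]; ring
    rw [aux_deriv_P L hz, ← aux_P_split, L.derivWeierstrassP_sq z hz, hder]
    have e1 := aux_deriv_P L hz2
    have e2 := aux_P_split L (aρ * z)
    have e3 := L.derivWeierstrassP_sq (aρ * z) hz2
    have e4 : aρ ^ 3 * deriv (L.weierstrassPExcept 0) (aρ * z) - 2 / z ^ 3
        = aρ ^ 3 * L.derivWeierstrassP (aρ * z) := by
      rw [← e1]; field_simp
    have e5 : aρ ^ 2 * L.weierstrassPExcept 0 (aρ * z) + 1 / z ^ 2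
        = aρ ^ 2 * L.weierstrassP (aρ * z) := by
      rw [e2]; field_simp
    rw [e4, e5, h2, mul_pow, e3, h2]
    have := aρ_six
    linear_combination L.g₃ * this

lemma aux_zero_unique (L : PeriodPair) {z₀ z₁ : ℂ} (h0 : z₀ ∉ L.lattice) (h1 : z₁ ∉ L.lattice)
    (he : L.weierstrassP z₀ = L.weierstrassP z₁) (h2 : L.g₂ = 0)
    (hd : L.derivWeierstrassP z₀ = L.derivWeierstrassP z₁) (hd0 : L.derivWeierstrassP z₀ ≠ 0) :
    z₀ - z₁ ∈ L.lattice := by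
  have ha : ∀ w, w ∉ L.lattice → AnalyticAt ℂ (fun t => L.weierstrassP (t + w)) 0 := by
    intro w hw
    have : AnalyticAt ℂ L.weierstrassP (0 + w) := by
      simpa using L.analyticOnNhd_weierstrassP w hw
    exact this.comp (f := fun t => t + w) (by fun_prop)
  have ha' : ∀ w, w ∉ L.lattice → AnalyticAt ℂ (fun t => L.derivWeierstrassP (t + w)) 0 := by
    intro w hw
    have : AnalyticAt ℂ L.derivWeierstrassP (0 + w) := by
      simpa using L.analyticOnNhd_derivWeierstrassP w hw
    exact this.comp (f := fun t => t + w) (by fun_prop)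
  have hnear : ∀ w, w ∉ L.lattice → ∀ᶠ t in 𝓝 (0 : ℂ), t + w ∉ L.lattice := by
    intro w hw
    have hc : Continuous fun t : ℂ => t + w := by fun_prop
    have := hc.continuousAt (x := 0) |>.preimage_mem_nhds
      (L.isClosed_lattice.isOpen_compl.mem_nhds (by simpa using hw))
    exact this
  have hm := aux_uniqueM
    (A := fun t => L.derivWeierstrassP (t + z₁) + L.derivWeierstrassP (t + z₀))
    (B := fun t => t * (4 * (L.weierstrassP (t + z₁) ^ 2 + L.weierstrassP (t + z₁) *
      L.weierstrassP (t + z₀) + L.weierstrassP (t + z₀) ^ 2)))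
    (D := fun t => L.weierstrassP (t + z₁) - L.weierstrassP (t + z₀))
    ((ha' _ h1).add (ha' _ h0)).continuousAt
    (by have := (ha _ h1).continuousAt; have := (ha _ h0).continuousAt; fun_prop)
    ((ha _ h1).sub (ha _ h0)) ?_ ?_
  · have := aux_pole_affine L 1 1 (z₀ - z₁) (x := z₁) ?_ (zero_mem _)
    · simpa using this
    · have ht : Tendsto (fun z : ℂ => z - z₁) (𝓝 z₁) (𝓝 0) := by
        have : Continuous fun z : ℂ => z - z₁ := by fun_prop
        simpa using this.tendsto z₁
      filter_upwards [nhdsWithin_le_nhds (ht.eventually hm)] with z hz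
      rw [sub_add_cancel, sub_eq_zero] at hz
      rw [hz]; ring_nf
  · filter_upwards [nhdsWithin_le_nhds (hnear _ h0), nhdsWithin_le_nhds (hnear _ h1)] with t h3 h4
    have hda : ∀ w, t + w ∉ L.lattice →
        HasDerivAt (fun t => L.weierstrassP (t + w)) (L.derivWeierstrassP (t + w)) t := by
      intro w hw
      have := (L.analyticOnNhd_weierstrassP _ hw).differentiableAt.hasDerivAt
      rw [L.deriv_weierstrassP] at this
      exact this.comp_add_const t w
    rw [((hda _ h4).fun_sub (hda _ h3)).deriv]
    have e1 := L.derivWeierstrassP_sq _ h3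
    have e2 := L.derivWeierstrassP_sq _ h4
    rw [h2] at e1 e2
    linear_combination t * e2 - t * e1
  · intro N hN
    simp only [zero_add, zero_mul]
    have hN0 : N ≠ 0 := fun h => hN h (by simp [he])
    rw [← hd, ← two_mul]
    simp [hN0, hd0]

lemma aux_tsum_equiv {Λ Λ' : Set ℂ} (σ : ℂ ≃ ℂ) (h0 : σ 0 = 0)
    (hσ : ∀ l, σ l ∈ Λ' ↔ l ∈ Λ) (f : ℂ → ℂ) :
    ∑' l : {l : ℂ // l ∈ Λ' ∧ l ≠ 0}, f l = ∑' l : {l : ℂ // l ∈ Λ ∧ l ≠ 0}, f (σ l) := by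
  let e : {l : ℂ // l ∈ Λ ∧ l ≠ 0} ≃ {l : ℂ // l ∈ Λ' ∧ l ≠ 0} :=
    σ.subtypeEquiv (fun a => by
      rw [hσ]
      have : σ a = 0 ↔ a = 0 := by rw [← h0, σ.injective.eq_iff]; simp [h0]
      simp [this])
  exact (e.tsum_eq (fun l => f l)).symm

lemma aux_g2_scale {Λ Λ' : Set ℂ} {c : ℂ} (hc : c ≠ 0) (h : ∀ l, c * l ∈ Λ' ↔ l ∈ Λ) :
    c ^ 4 * g2 Λ' = g2 Λ := by
  unfold g2
  rw [aux_tsum_equiv (Equiv.mulLeft₀ c hc) (by simp) (by simpa using h) (fun l => (l ^ 4)⁻¹)]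
  simp only [Equiv.mulLeft₀_apply, mul_pow, mul_inv, tsum_mul_left]
  field_simp

lemma aux_g3_scale {Λ Λ' : Set ℂ} {c : ℂ} (hc : c ≠ 0) (h : ∀ l, c * l ∈ Λ' ↔ l ∈ Λ) :
    c ^ 6 * g3 Λ' = g3 Λ := by
  unfold g3
  rw [aux_tsum_equiv (Equiv.mulLeft₀ c hc) (by simp) (by simpa using h) (fun l => (l ^ 6)⁻¹)]
  simp only [Equiv.mulLeft₀_apply, mul_pow, mul_inv, tsum_mul_left]
  field_simp

lemma aux_wp_scale {Λ Λ' : Set ℂ} {c : ℂ} (hc : c ≠ 0) (h : ∀ l, c * l ∈ Λ' ↔ l ∈ Λ) (z : ℂ) :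
    c ^ 2 * wp Λ' (c * z) = wp Λ z := by
  unfold wp
  rw [aux_tsum_equiv (Equiv.mulLeft₀ c hc) (by simp) (by simpa using h)
    (fun l => 1 / (c * z - l) ^ 2 - 1 / l ^ 2)]
  simp only [Equiv.mulLeft₀_apply, ← mul_sub, mul_pow, one_div, mul_inv, tsum_mul_left]
  field_simp

lemma aux_wp_conj {Λ : Set ℂ} (h : ∀ l, (starRingEnd ℂ) l ∈ Λ ↔ l ∈ Λ) (z : ℂ) :
    wp Λ ((starRingEnd ℂ) z) = (starRingEnd ℂ) (wp Λ z) := by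
  unfold wp
  rw [aux_tsum_equiv (starRingAut (R := ℂ)).toEquiv (by simp) (by simpa using h)
    (fun l => 1 / ((starRingEnd ℂ) z - l) ^ 2 - 1 / l ^ 2)]
  rw [map_add, Complex.conj_tsum]
  congr 1
  · simp
  · congr 1
    ext l
    simp only [map_sub, map_div₀, map_pow, map_one]
    rfl

lemma aux_mem_hex {w z : ℂ} :
    z ∈ hexLattice w ↔ ∃ m n : ℤ, z = (m : ℂ) * w + (n : ℂ) * (w * aρ) := Iff.rfl

lemma aux_hex_scale {c w : ℂ} (hc : c ≠ 0) (l : ℂ) :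
    c * l ∈ hexLattice (c * w) ↔ l ∈ hexLattice w := by
  simp only [aux_mem_hex]
  constructor
  · rintro ⟨m, n, h⟩
    refine ⟨m, n, mul_left_cancel₀ hc ?_⟩
    rw [h]; ring
  · rintro ⟨m, n, rfl⟩
    exact ⟨m, n, by ring⟩

lemma aux_hex_rho (w : ℂ) : hexLattice (aρ * w) = hexLattice w := by
  have := aρ_sq
  ext z
  simp only [aux_mem_hex]
  constructor
  · rintro ⟨m, n, rfl⟩
    refine ⟨-n, m + n, ?_⟩
    push_cast
    linear_combination (n : ℂ) * w * this
  · rintro ⟨m, n, rfl⟩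
    refine ⟨m + n, -m, ?_⟩
    push_cast
    linear_combination (m : ℂ) * w * this

lemma aux_hex_rho_pow (w : ℂ) (k : ℕ) : hexLattice (aρ ^ k * w) = hexLattice w := by
  induction k with
  | zero => simp
  | succ k ih => rw [pow_succ', mul_assoc, aux_hex_rho, ih]

lemma aux_hex_rot (w l : ℂ) : aρ * l ∈ hexLattice w ↔ l ∈ hexLattice w := by
  conv_lhs => rw [← aux_hex_rho w]
  exact aux_hex_scale aρ_ne l

lemma aux_hex_g2 (w : ℂ) : g2 (hexLattice w) = 0 := by
  have h := aux_g2_scale aρ_ne (aux_hex_rot w)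
  have h4 : aρ ^ 4 - 1 ≠ 0 := by
    rw [sub_ne_zero]
    exact aρ_prim.pow_ne_one_of_pos_of_lt (by norm_num) (by norm_num)
  have : (aρ ^ 4 - 1) * g2 (hexLattice w) = 0 := by linear_combination h
  exact (mul_eq_zero.mp this).resolve_left h4

lemma aux_hex_of_rot (L : PeriodPair) (h : ∀ l ∈ L.lattice, aρ * l ∈ L.lattice) :
    ∃ ω : ℂ, ω ≠ 0 ∧ (L.lattice : Set ℂ) = hexLattice ω := by
  have hω₁ : L.ω₁ ≠ 0 := by
    intro h0
    exact L.ω₁_div_two_notMem_lattice (by rw [h0]; simp)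
  obtain ⟨ω, hω, hω0, hmin⟩ : ∃ ω ∈ L.lattice, ω ≠ 0 ∧
      ∀ l ∈ L.lattice, ‖l‖ < ‖ω‖ → l = 0 := by
    have hfin : (Metric.closedBall (0 : ℂ) ‖L.ω₁‖ ∩ (L.lattice : Set ℂ)).Finite :=
      Metric.finite_isBounded_inter_isClosed
        (isDiscrete_iff_discreteTopology.mpr (inferInstanceAs (DiscreteTopology L.lattice)))
        Metric.isBounded_closedBall L.isClosed_lattice
    have hfin2 := hfin.subset (Set.sdiff_subset (t := {0}))
    obtain ⟨ω, ⟨⟨h1, h2⟩, h3⟩, h4⟩ := hfin2.exists_minimalFor (fun z => ‖z‖) _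
      ⟨L.ω₁, ⟨by simp, L.ω₁_mem_lattice⟩, hω₁⟩
    refine ⟨ω, h2, h3, fun l hl hlt => ?_⟩
    by_contra hl0
    have hb : ‖l‖ ≤ ‖L.ω₁‖ := hlt.le.trans (by simpa using h1)
    have := h4 (j := l) ⟨⟨by simpa using hb, hl⟩, hl0⟩ hlt.le
    exact absurd hlt (not_lt.mpr this)
  refine ⟨ω, hω0, ?_⟩
  have hsub : ∀ m n : ℤ, (m : ℂ) * ω + (n : ℂ) * (ω * aρ) ∈ L.lattice := by
    intro m n
    have h1 := L.lattice.smul_mem m hω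
    have h2 := L.lattice.smul_mem n (h ω hω)
    have := add_mem h1 h2
    simpa [mul_comm ω aρ] using this
  ext z
  constructor
  · intro hz
    have hs3 : (0 : ℝ) < Real.sqrt 3 := by positivity
    have h3 : Real.sqrt 3 ^ 2 = 3 := Real.sq_sqrt (by norm_num)
    set q := z / ω with hq
    have hzq : z = q * ω := by rw [hq]; field_simp
    set y := 2 * q.im / Real.sqrt 3 with hy
    set x := q.re - y / 2 with hx
    have hqxy : q = x + y * aρ := by
      rw [aρ_val]
      apply Complex.ext
      · simp [hx]; ring
      · simp [hy]; field_simp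
    refine ⟨round x, round y, ?_⟩
    have hmem := sub_mem hz (hsub (round x) (round y))
    have e : z - ((round x : ℤ) * ω + (round y : ℤ) * (ω * aρ)) =
        ω * (((x - round x : ℝ) : ℂ) + ((y - round y : ℝ) : ℂ) * aρ) := by
      rw [hzq, hqxy]; push_cast; ring
    rw [e] at hmem
    have hzero := hmin _ hmem ?_
    · rw [← e] at hzero
      exact sub_eq_zero.mp hzero
    · rw [norm_mul]
      have ha := abs_sub_round x
      have hb := abs_sub_round y
      generalize x - round x = a at *
      generalize y - round y = b at *
      rw [abs_le] at ha hb
      have hn : ‖(a : ℂ) + (b : ℂ) * aρ‖ < 1 := by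
        have hsq : ‖(a : ℂ) + (b : ℂ) * aρ‖ ^ 2 = a ^ 2 + a * b + b ^ 2 := by
          rw [← Complex.normSq_eq_norm_sq, Complex.normSq_apply, aρ_val]
          simp
          nlinarith
        have : ‖(a : ℂ) + (b : ℂ) * aρ‖ ^ 2 < 1 := by
          rw [hsq]; nlinarith
        nlinarith [norm_nonneg ((a : ℂ) + (b : ℂ) * aρ)]
      have hpos : 0 < ‖ω‖ := norm_pos_iff.mpr hω0
      nlinarith
  · rintro ⟨m, n, rfl⟩
    exact hsub m n

/-- `exp (iπ/6)` -/
noncomputable def aτ : ℂ := Complex.exp ((Real.pi : ℂ) * Complex.I / 6)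

lemma aτ_ne : aτ ≠ 0 := Complex.exp_ne_zero _

lemma aτ_val : aτ = ⟨Real.sqrt 3 / 2, 1 / 2⟩ := by
  unfold aτ
  rw [show (Real.pi : ℂ) * Complex.I / 6 = ((Real.pi / 6 : ℝ) : ℂ) * Complex.I by push_cast; ring]
  apply Complex.ext
  · rw [Complex.exp_ofReal_mul_I_re, Real.cos_pi_div_six]
  · rw [Complex.exp_ofReal_mul_I_im, Real.sin_pi_div_six]

lemma aτ_norm : ‖aτ‖ = 1 := by
  unfold aτ
  rw [show (Real.pi : ℂ) * Complex.I / 6 = ((Real.pi / 6 : ℝ) : ℂ) * Complex.I by push_cast; ring]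
  exact Complex.norm_exp_ofReal_mul_I _

lemma aux_mul : aτ * aρ = Complex.I := by
  have h3 : Real.sqrt 3 ^ 2 = 3 := Real.sq_sqrt (by norm_num)
  rw [aτ_val, aρ_val]
  apply Complex.ext <;> simp <;> nlinarith

lemma aux_mem_hexr {r : ℝ} {z : ℂ} :
    z ∈ hexLattice (r * aτ) ↔ ∃ m n : ℤ, z.re = m * (Real.sqrt 3 * r / 2) ∧
      z.im = r * (m / 2 + n) := by
  rw [aux_mem_hex]
  refine exists_congr fun m => exists_congr fun n => ?_
  rw [mul_assoc (r : ℂ), aux_mul, aτ_val, Complex.ext_iff]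
  simp
  constructor
  · rintro ⟨h1, h2⟩; exact ⟨by rw [h1]; ring, by rw [h2]; ring⟩
  · rintro ⟨h1, h2⟩; exact ⟨by rw [h1]; ring, by rw [h2]; ring⟩

section pfour
variable {L : PeriodPair} {r : ℝ}

lemma h_mem (hL : (L.lattice : Set ℂ) = hexLattice (r * aτ)) {z : ℂ} :
    z ∈ L.lattice ↔ ∃ m n : ℤ, z.re = m * (Real.sqrt 3 * r / 2) ∧ z.im = r * (m / 2 + n) := by
  rw [← aux_mem_hexr, ← hL]; rfl

lemma h_g2 (hL : (L.lattice : Set ℂ) = hexLattice (r * aτ)) : L.g₂ = 0 := by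
  rw [← aux_g2, hL, aux_hex_g2]

lemma h_conj (hL : (L.lattice : Set ℂ) = hexLattice (r * aτ)) (z : ℂ) :
    L.weierstrassP ((starRingEnd ℂ) z) = (starRingEnd ℂ) (L.weierstrassP z) := by
  have key : ∀ l : ℂ, l ∈ (L.lattice : Set ℂ) → (starRingEnd ℂ) l ∈ (L.lattice : Set ℂ) := by
    intro l hl
    obtain ⟨m, n, h1, h2⟩ := (h_mem hL).1 hl
    refine (h_mem hL).2 ⟨m, -m - n, by simpa using h1, ?_⟩
    simp only [Complex.conj_im, h2]; push_cast; ring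
  rw [← aux_wp, ← aux_wp]
  refine aux_wp_conj (fun l => ⟨fun h => ?_, key l⟩) z
  simpa using key _ h

lemma h_conj' (hL : (L.lattice : Set ℂ) = hexLattice (r * aτ)) (z : ℂ) :
    L.derivWeierstrassP ((starRingEnd ℂ) z) = (starRingEnd ℂ) (L.derivWeierstrassP z) := by
  have h := deriv_conj_conj (f := L.weierstrassP)
  have e : ((starRingEnd ℂ) ∘ L.weierstrassP ∘ (starRingEnd ℂ)) = L.weierstrassP := by
    funext w; simp [h_conj hL]
  rw [e, L.deriv_weierstrassP] at h
  have := congrFun h ((starRingEnd ℂ) z)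
  simpa using this

lemma h_real (hL : (L.lattice : Set ℂ) = hexLattice (r * aτ)) (x : ℝ) :
    (L.weierstrassP x).im = 0 := by
  have := h_conj hL x
  rw [Complex.conj_ofReal] at this
  exact Complex.conj_eq_iff_im.1 this.symm

lemma h_real' (hL : (L.lattice : Set ℂ) = hexLattice (r * aτ)) (x : ℝ) :
    (L.derivWeierstrassP x).im = 0 := by
  have := h_conj' hL x
  rw [Complex.conj_ofReal] at this
  exact Complex.conj_eq_iff_im.1 this.symm

lemma h_realmem (hr : 0 < r) (hL : (L.lattice : Set ℂ) = hexLattice (r * aτ)) (x : ℝ) :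
    (x : ℂ) ∈ L.lattice ↔ ∃ k : ℤ, x = k * (Real.sqrt 3 * r) := by
  rw [h_mem hL]
  constructor
  · rintro ⟨m, n, h1, h2⟩
    simp only [Complex.ofReal_re, Complex.ofReal_im] at h1 h2
    have : (m : ℝ) / 2 + n = 0 := by
      rcases mul_eq_zero.1 h2.symm with h | h
      · exact absurd h hr.ne'
      · exact h
    refine ⟨-n, ?_⟩
    have hm : (m : ℝ) = -2 * n := by linarith
    rw [h1, hm]; push_cast; ring
  · rintro ⟨k, h⟩
    refine ⟨2 * k, -k, ?_, ?_⟩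
    · simp [h]; ring
    · simp

lemma h_T (hr : 0 < r) (hL : (L.lattice : Set ℂ) = hexLattice (r * aτ)) :
    ((Real.sqrt 3 * r : ℝ) : ℂ) ∈ L.lattice :=
  (h_realmem hr hL _).2 ⟨1, by simp⟩

lemma h_Tpos (hr : 0 < r) : 0 < Real.sqrt 3 * r := by positivity

lemma h_z0 (hr : 0 < r) (hL : (L.lattice : Set ℂ) = hexLattice (r * aτ)) :
    ((Real.sqrt 3 * r / 3 : ℝ) : ℂ) ∉ L.lattice := by
  rw [h_realmem hr hL]
  rintro ⟨k, hk⟩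
  have hT := h_Tpos hr
  have : (Real.sqrt 3 * r) * (3 * k - 1) = 0 := by linarith
  rcases mul_eq_zero.1 this with h | h
  · exact hT.ne' h
  · have : (3 * k - 1 : ℤ) = 0 := by exact_mod_cast h
    omega

lemma h_P0 (hL : (L.lattice : Set ℂ) = hexLattice (r * aτ)) :
    L.weierstrassP ((Real.sqrt 3 * r / 3 : ℝ) : ℂ) = 0 := by
  set z : ℂ := ((Real.sqrt 3 * r / 3 : ℝ) : ℂ) with hz
  have hrot : ∀ l, aρ ^ 2 * l ∈ (L.lattice : Set ℂ) ↔ l ∈ (L.lattice : Set ℂ) := by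
    intro l
    rw [hL, pow_two, mul_assoc, aux_hex_rot, aux_hex_rot]
  have h1 := aux_wp_scale (pow_ne_zero 2 aρ_ne) hrot z
  rw [aux_wp, aux_wp] at h1
  have h3 : Real.sqrt 3 * Real.sqrt 3 = 3 := Real.mul_self_sqrt (by norm_num)
  have h2 : aρ ^ 2 * z - z ∈ L.lattice := by
    refine (h_mem hL).2 ⟨-1, 1, ?_, ?_⟩
    · rw [aρ_sq, aρ_val, hz]; simp; ring
    · rw [aρ_sq, aρ_val, hz]; simp; linear_combination (r / 6) * h3
  have h4 := L.weierstrassP_add_coe z ⟨_, h2⟩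
  simp only [add_sub_cancel] at h4
  rw [h4] at h1
  have h5 : ((aρ ^ 2) ^ 2 - 1) * L.weierstrassP z = 0 := by linear_combination h1
  rcases mul_eq_zero.1 h5 with h | h
  · exfalso
    have : (aρ ^ 2) ^ 2 = -aρ := by rw [aρ_sq]; linear_combination aρ_sq
    rw [this, aρ_val] at h
    have := congrArg Complex.re h
    norm_num at this
  · exact h

lemma h_g3 (hr : 0 < r) (hL : (L.lattice : Set ℂ) = hexLattice (r * aτ)) :
    L.g₃.im = 0 ∧ L.g₃.re < 0 := by
  have h := L.derivWeierstrassP_sq _ (h_z0 hr hL)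
  rw [h_P0 hL] at h
  have him := h_real' hL (Real.sqrt 3 * r / 3)
  set D := L.derivWeierstrassP ((Real.sqrt 3 * r / 3 : ℝ) : ℂ)
  have hD : D = (D.re : ℂ) := Complex.ext (by simp) (by simp [him])
  have hg : L.g₃ = ((-(D.re ^ 2) : ℝ) : ℂ) := by
    rw [hD] at h; push_cast; linear_combination h
  have hne := aux_g3_ne L (h_g2 hL)
  rw [hg] at hne ⊢
  have : D.re ≠ 0 := by
    rintro h0; apply hne; simp [h0]
  refine ⟨Complex.ofReal_im _, ?_⟩
  rw [Complex.ofReal_re]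
  have : 0 < D.re ^ 2 := by positivity
  linarith

lemma h_zeros (hr : 0 < r) (hL : (L.lattice : Set ℂ) = hexLattice (r * aτ)) (z : ℂ) :
    (z ∉ L.lattice ∧ L.weierstrassP z = 0) ↔
      ∃ l ∈ L.lattice, z = ((Real.sqrt 3 * r / 3 : ℝ) : ℂ) + l ∨
          z = ((2 * Real.sqrt 3 * r / 3 : ℝ) : ℂ) + l := by
  have hz0 := h_z0 hr hL
  have hP0 := h_P0 hL
  have hT := h_T hr hL
  have e2 : ((2 * Real.sqrt 3 * r / 3 : ℝ) : ℂ) =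
      -((Real.sqrt 3 * r / 3 : ℝ) : ℂ) + ((Real.sqrt 3 * r : ℝ) : ℂ) := by push_cast; ring
  rw [e2]
  set z₀ : ℂ := ((Real.sqrt 3 * r / 3 : ℝ) : ℂ)
  set T : ℂ := ((Real.sqrt 3 * r : ℝ) : ℂ)
  have hnz0 : -z₀ ∉ L.lattice := by rwa [neg_mem_iff]
  have hPn : L.weierstrassP (-z₀) = 0 := by rw [L.weierstrassP_neg, hP0]
  constructor
  · rintro ⟨hz, hP⟩
    have a1 := L.derivWeierstrassP_sq z hz
    have a2 := L.derivWeierstrassP_sq z₀ hz0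
    rw [hP] at a1
    rw [hP0] at a2
    have hne := aux_g3_ne L (h_g2 hL)
    have hd : L.derivWeierstrassP z ≠ 0 := by
      intro h0; rw [h0] at a1; apply hne; linear_combination a1
    have hs : L.derivWeierstrassP z ^ 2 = L.derivWeierstrassP z₀ ^ 2 := by rw [a1, a2]
    rcases sq_eq_sq_iff_eq_or_eq_neg.1 hs with h | h
    · exact ⟨_, aux_zero_unique L hz hz0 (by rw [hP, hP0]) (h_g2 hL) h hd, Or.inl (by ring)⟩
    · have := aux_zero_unique L hz hnz0 (by rw [hP, hPn]) (h_g2 hL)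
        (by rw [h, L.derivWeierstrassP_neg]) hd
      exact ⟨_, sub_mem this hT, Or.inr (by ring)⟩
  · rintro ⟨l, hl, h | h⟩
    · subst h
      exact ⟨fun h => hz0 ((add_mem_cancel_right hl).1 h),
        by rw [← hP0]; exact L.weierstrassP_add_coe z₀ ⟨l, hl⟩⟩
    · rw [add_assoc] at h
      subst h
      exact ⟨fun h => hnz0 ((add_mem_cancel_right (add_mem hT hl)).1 h),
        by rw [← hPn]; exact L.weierstrassP_add_coe (-z₀) ⟨_, add_mem hT hl⟩⟩

lemma h_lim (hr : 0 < r) (hL : (L.lattice : Set ℂ) = hexLattice (r * aτ)) :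
    Tendsto (fun x : ℝ => (L.weierstrassP (x : ℂ)).re) (𝓝[<] (Real.sqrt 3 * r)) atTop := by
  have hT := h_T hr hL
  set T : ℝ := Real.sqrt 3 * r
  have e : (fun x : ℝ => (L.weierstrassP (x : ℂ)).re) =
      fun x : ℝ => (L.weierstrassPExcept 0 ((x - T : ℝ) : ℂ)).re + ((x - T) ^ 2)⁻¹ := by
    funext x
    have h1 := L.weierstrassP_sub_coe x ⟨_, hT⟩
    simp only at h1
    rw [← h1, aux_P_split, ← Complex.ofReal_sub, Complex.add_re]
    congr 1
    rw [← Complex.ofReal_pow, one_div, ← Complex.ofReal_inv, Complex.ofReal_re]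
  rw [e]
  have hc : ContinuousAt (fun x : ℝ => (L.weierstrassPExcept 0 ((x - T : ℝ) : ℂ)).re) T := by
    have h0 := (L.analyticAt_weierstrassPExcept 0).continuousAt
    refine Complex.continuous_re.continuousAt.comp ?_
    refine ContinuousAt.comp (g := L.weierstrassPExcept 0) (f := fun x : ℝ => ((x - T : ℝ) : ℂ)) ?_ ?_
    · simpa using h0
    · fun_prop
  refine Tendsto.add_atTop (hc.tendsto.mono_left nhdsWithin_le_nhds) ?_
  refine tendsto_inv_nhdsGT_zero.comp ?_
  refine tendsto_nhdsWithin_iff.2 ⟨?_, ?_⟩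
  · have : ContinuousAt (fun x : ℝ => (x - T) ^ 2) T := by fun_prop
    have h := this.tendsto.mono_left (nhdsWithin_le_nhds (s := Iio T))
    simpa using h
  · filter_upwards [self_mem_nhdsWithin] with x hx
    have : x - T ≠ 0 := sub_ne_zero.2 (ne_of_lt hx)
    exact mem_Ioi.2 (by positivity)

lemma h_mono (hr : 0 < r) (hL : (L.lattice : Set ℂ) = hexLattice (r * aτ)) :
    StrictMonoOn (fun x : ℝ => (L.weierstrassP (x : ℂ)).re)
        (Ioo (2 * Real.sqrt 3 * r / 3) (Real.sqrt 3 * r)) := by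
  have hTp := h_Tpos hr
  have hlim := h_lim hr hL
  have hrm := h_realmem hr hL
  have hz := h_zeros hr hL
  have hg := h_g3 hr hL
  have e1 : 2 * Real.sqrt 3 * r / 3 = 2 * (Real.sqrt 3 * r) / 3 := by ring
  rw [e1] at hz ⊢
  set T : ℝ := Real.sqrt 3 * r
  set φ : ℝ → ℝ := fun x : ℝ => (L.weierstrassP (x : ℂ)).re with hφ
  set φ' : ℝ → ℝ := fun x : ℝ => (L.derivWeierstrassP (x : ℂ)).re with hφ'
  set S := Ioo (2 * T / 3) T with hS
  have hSconv : Convex ℝ S := convex_Ioo _ _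
  have hSmem : S ∈ 𝓝[<] T := Ioo_mem_nhdsLT (by linarith)
  have hnm : ∀ x ∈ S, (x : ℂ) ∉ L.lattice := by
    rintro x ⟨hx1, hx2⟩ hx
    obtain ⟨k, hk⟩ := (hrm x).1 hx
    have b1 : (k : ℝ) < 1 := by by_contra hh; push Not at hh; nlinarith
    have b2 : (0 : ℝ) < k := by by_contra hh; push Not at hh; nlinarith
    have : k < 1 := by exact_mod_cast b1
    have : 0 < k := by exact_mod_cast b2
    omega
  have hnz : ∀ x ∈ S, L.weierstrassP (x : ℂ) ≠ 0 := by
    intro x hx h0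
    obtain ⟨l, hl, h⟩ := (hz x).1 ⟨hnm x hx, h0⟩
    obtain ⟨hx1, hx2⟩ := hx
    rcases h with h | h
    · have hl' : l = ((x - T / 3 : ℝ) : ℂ) := by push_cast at h ⊢; linear_combination -h
      rw [hl'] at hl
      obtain ⟨k, hk⟩ := (hrm _).1 hl
      have b1 : (k : ℝ) < 1 := by by_contra hh; push Not at hh; nlinarith
      have b2 : (0 : ℝ) < k := by by_contra hh; push Not at hh; nlinarith
      have : k < 1 := by exact_mod_cast b1
      have : 0 < k := by exact_mod_cast b2
      omega
    · have hl' : l = ((x - 2 * T / 3 : ℝ) : ℂ) := by push_cast at h ⊢; linear_combination -h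
      rw [hl'] at hl
      obtain ⟨k, hk⟩ := (hrm _).1 hl
      have b1 : (k : ℝ) < 1 := by by_contra hh; push Not at hh; nlinarith
      have b2 : (0 : ℝ) < k := by by_contra hh; push Not at hh; nlinarith
      have : k < 1 := by exact_mod_cast b1
      have : 0 < k := by exact_mod_cast b2
      omega
  have hre : ∀ x : ℝ, L.weierstrassP (x : ℂ) = (φ x : ℂ) := fun x =>
    Complex.ext (by simp [hφ]) (by simp [h_real hL])
  have hre' : ∀ x : ℝ, L.derivWeierstrassP (x : ℂ) = (φ' x : ℂ) := fun x =>
    Complex.ext (by simp [hφ']) (by simp [h_real' hL])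
  have hder : ∀ x ∈ S, HasDerivAt φ (φ' x) x := by
    intro x hx
    have h1 : DifferentiableAt ℂ L.weierstrassP (x : ℂ) :=
      (L.analyticOnNhd_weierstrassP x (hnm x hx)).differentiableAt
    have h2 := h1.hasDerivAt
    rw [L.deriv_weierstrassP] at h2
    exact h2.real_of_complex
  have hcont : ContinuousOn φ S := fun x hx => (hder x hx).continuousAt.continuousWithinAt
  have hpos : ∀ x ∈ S, 0 < φ x := by
    intro x hx
    by_contra hh
    push Not at hh
    obtain ⟨y, hy, hy0⟩ := hSconv.isPreconnected.intermediate_value₂_eventually₁ (l := 𝓝[<] T)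
      (g := fun _ => 0) hx (le_principal_iff.2 hSmem) hcont continuousOn_const hh
      (hlim.eventually_ge_atTop 0)
    apply hnz y hy
    rw [hre, hy0]; simp
  have hne : ∀ x ∈ S, φ' x ≠ 0 := by
    intro x hx h0
    have h := L.derivWeierstrassP_sq x (hnm x hx)
    rw [hre, hre', h0, h_g2 hL] at h
    have h' : (4 * (φ x : ℂ) ^ 3) = L.g₃ := by
      push_cast at h; linear_combination -h
    have h'' : 4 * φ x ^ 3 = L.g₃.re := by
      rw [← h']; norm_cast
    have := hpos x hx
    have : 0 < 4 * φ x ^ 3 := by positivity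
    linarith [hg.2]
  have hint : interior S = S := isOpen_Ioo.interior_eq
  rcases hasDerivWithinAt_forall_lt_or_forall_gt_of_forall_ne hSconv
    (fun x hx => (hder x hx).hasDerivWithinAt) hne with h | h
  · exfalso
    have hanti : StrictAntiOn φ S := strictAntiOn_of_hasDerivWithinAt_neg hSconv hcont
      (f' := φ') (by rw [hint]; exact fun x hx => (hder x hx).hasDerivWithinAt)
      (by rw [hint]; exact h)
    have ha : 5 * T / 6 ∈ S := ⟨by linarith, by linarith⟩
    have hmem : Ioo (5 * T / 6) T ∈ 𝓝[<] T := Ioo_mem_nhdsLT (by linarith)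
    obtain ⟨x, ⟨hx1, hx2⟩, hx3⟩ :=
      ((eventually_mem_set.2 hmem).and (hlim.eventually_ge_atTop (φ (5 * T / 6)))).exists
    have := hanti ha (show x ∈ S from ⟨by linarith, hx2⟩) hx1
    linarith
  · exact strictMonoOn_of_hasDerivWithinAt_pos hSconv hcont
      (f' := φ') (by rw [hint]; exact fun x hx => (hder x hx).hasDerivWithinAt)
      (by rw [hint]; exact h)

lemma h_isLattice (hr : 0 < r) : IsLattice (hexLattice (r * aτ)) := by
  refine ⟨r * aτ, r * aτ * aρ, ?_, rfl⟩
  have : (r : ℂ) * aτ ≠ 0 := mul_ne_zero (by exact_mod_cast hr.ne') aτ_ne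
  rw [mul_div_cancel_left₀ _ this, aρ_val]
  simp

lemma h_norm_root {ω : ℂ} (hω : ω ≠ 0) (h1 : (g3 (hexLattice ω)).im = 0)
    (h2 : (g3 (hexLattice ω)).re < 0) : ∃ r : ℝ, 0 < r ∧ hexLattice ω = hexLattice (r * aτ) := by
  have hr : 0 < ‖ω‖ := norm_pos_iff.2 hω
  refine ⟨‖ω‖, hr, ?_⟩
  obtain ⟨L, hL⟩ := aux_exists_pair (h_isLattice hr)
  obtain ⟨k1, k2⟩ := h_g3 hr hL.symm
  rw [← aux_g3, ← hL] at k1 k2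
  have hw : ((‖ω‖ : ℝ) : ℂ) * aτ ≠ 0 := mul_ne_zero (by exact_mod_cast hr.ne') aτ_ne
  set w : ℂ := ((‖ω‖ : ℝ) : ℂ) * aτ with hwdef
  have hwn : ‖w‖ = ‖ω‖ := by rw [hwdef, norm_mul, aτ_norm]; simp
  set u := ω / w with hu
  have huw : ω = u * w := by rw [hu]; field_simp
  have hu0 : u ≠ 0 := div_ne_zero hω hw
  have hun : ‖u‖ = 1 := by rw [hu, norm_div, hwn]; exact div_self hr.ne'
  have hs := aux_g3_scale (Λ := hexLattice w) (Λ' := hexLattice ω) hu0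
    (fun l => by rw [huw]; exact aux_hex_scale hu0 l)
  set A := g3 (hexLattice ω)
  set B := g3 (hexLattice w)
  have hA : A = (A.re : ℂ) := Complex.ext (by simp) (by simp [h1])
  have hB : B = (B.re : ℂ) := Complex.ext (by simp) (by simp [k1])
  have hnorm : ‖A‖ = ‖B‖ := by rw [← hs, norm_mul, norm_pow, hun]; simp
  rw [hA, hB, Complex.norm_real, Complex.norm_real, Real.norm_eq_abs, Real.norm_eq_abs,
    abs_of_neg h2, abs_of_neg k2] at hnorm
  have hAB : A = B := by rw [hA, hB]; norm_cast; linarith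
  have hA0 : A ≠ 0 := by intro h; rw [h] at h2; simp at h2
  have hu6 : u ^ 6 = 1 := by
    rw [← hAB] at hs
    exact mul_right_cancel₀ hA0 (by rw [hs, one_mul])
  obtain ⟨k, -, hk⟩ := aρ_prim.eq_pow_of_pow_eq_one hu6
  rw [huw, ← hk, aux_hex_rho_pow]

end pfour

/-- A lattice has `g₂ = 0` and `g₃ ≠ 0` iff it is hexagonal; `g₃ < 0` iff it is hexagonal
with `ω = |ω| e^{iπ/6}`, in which case `℘_Λ` is real on `ℝ ∖ Λ`, its real poles are the
integer multiples of `√3 |ω|`, its zeros (mod `Λ`) are `√3|ω|/3` and `2√3|ω|/3`, and it is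
strictly increasing on `(2√3|ω|/3, √3|ω|)`. -/
theorem antiequianharmonic (Λ : Set ℂ) (hΛ : IsLattice Λ) :
    ((g2 Λ = 0 ∧ g3 Λ ≠ 0) ↔ ∃ ω : ℂ, ω ≠ 0 ∧ Λ = hexLattice ω) ∧
    ((g2 Λ = 0 ∧ (g3 Λ).im = 0 ∧ (g3 Λ).re < 0) ↔
      ∃ r : ℝ, 0 < r ∧
        Λ = hexLattice ((r : ℂ) * Complex.exp ((Real.pi : ℂ) * Complex.I / 6))) ∧
    (∀ r : ℝ, 0 < r →
      Λ = hexLattice ((r : ℂ) * Complex.exp ((Real.pi : ℂ) * Complex.I / 6)) →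
      (∀ x : ℝ, (x : ℂ) ∉ Λ → (wp Λ (x : ℂ)).im = 0) ∧
      ({x : ℝ | (x : ℂ) ∈ Λ} = {x : ℝ | ∃ k : ℤ, x = (k : ℝ) * (Real.sqrt 3 * r)}) ∧
      ({z : ℂ | z ∉ Λ ∧ wp Λ z = 0} =
        {z : ℂ | ∃ l ∈ Λ, z = ((Real.sqrt 3 * r / 3 : ℝ) : ℂ) + l ∨
          z = ((2 * Real.sqrt 3 * r / 3 : ℝ) : ℂ) + l}) ∧
      StrictMonoOn (fun x : ℝ => (wp Λ (x : ℂ)).re)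
        (Ioo (2 * Real.sqrt 3 * r / 3) (Real.sqrt 3 * r))) := by

  obtain ⟨L, rfl⟩ := aux_exists_pair hΛ
  have hiff : ∀ ω : ℂ, ω ≠ 0 → (L.lattice : Set ℂ) = hexLattice ω → L.g₂ = 0 := by
    intro ω _ h
    rw [← aux_g2, h, aux_hex_g2]
  have hex : L.g₂ = 0 → ∃ ω : ℂ, ω ≠ 0 ∧ (L.lattice : Set ℂ) = hexLattice ω := by
    intro h
    obtain ⟨ω, h0, h1⟩ := aux_hex_of_rot L (fun l hl => aux_rot L h hl)
    exact ⟨ω, h0, h1⟩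
  refine ⟨?_, ?_, ?_⟩
  · rw [aux_g2, aux_g3]
    constructor
    · exact fun h => hex h.1
    · rintro ⟨ω, h0, h1⟩
      exact ⟨hiff ω h0 h1, aux_g3_ne L (hiff ω h0 h1)⟩
  · constructor
    · rintro ⟨h1, h2, h3⟩
      rw [aux_g2] at h1
      obtain ⟨ω, h0, hω⟩ := hex h1
      rw [hω] at h2 h3 ⊢
      exact h_norm_root h0 h2 h3
    · rintro ⟨r, hr, h⟩
      rw [aux_g2, aux_g3]
      exact ⟨h_g2 h, h_g3 hr h⟩
  · intro r hr h
    have hw : wp (L.lattice : Set ℂ) = L.weierstrassP := funext (aux_wp L)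
    rw [hw]
    refine ⟨fun x _ => h_real h x, ?_, ?_, h_mono hr h⟩
    · ext x; exact h_realmem hr h x
    · ext z; exact h_zeros hr h z
end

section
/- Let y > 0 and c = y/√6, and let F(s) = s·(1 + c·√(1−s))⁻² (principal branch of the square root), analytic on the open unit disk. Then the Taylor coefficients a_k of F at s = 0 satisfy lim_{k→∞} k^{3/2}·a_k = y/√(6π). -/
open Filter

noncomputable def kp (m n : ℕ) : ℝ :=
  if n = 0 ∧ m = 0 then 1 else (m : ℝ) / ((2 * n - m : ℕ) : ℝ) *
    (((2 * n - m).choose n : ℝ) / 2 ^ (2 * n - m))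

lemma kp_zero_zero : kp 0 0 = 1 := by simp [kp]
lemma kp_zero_succ (n : ℕ) : kp 0 (n+1) = 0 := by simp [kp]
lemma kp_succ_zero (m : ℕ) : kp (m+1) 0 = 0 := by simp [kp]

lemma kp_lt {m n : ℕ} (h : n < m) : kp m n = 0 := by
  unfold kp
  rw [if_neg (by omega)]
  rcases Nat.eq_zero_or_pos n with rfl | hn
  · simp
  · rw [Nat.choose_eq_zero_of_lt (by omega)]; simp

lemma kp_nonneg (m n : ℕ) : 0 ≤ kp m n := by
  unfold kp; split_ifs <;> positivity

lemma kp_le_one (m n : ℕ) : kp m n ≤ 1 := by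
  rcases lt_or_ge n m with h | h
  · rw [kp_lt h]; norm_num
  unfold kp
  split_ifs with h0
  · norm_num
  have h1 : (m : ℝ) / ((2 * n - m : ℕ) : ℝ) ≤ 1 := by
    apply div_le_one_of_le₀ _ (by positivity)
    exact_mod_cast (by omega : m ≤ 2 * n - m)
  have h2 : (((2 * n - m).choose n : ℝ) / 2 ^ (2 * n - m)) ≤ 1 := by
    apply div_le_one_of_le₀ _ (by positivity)
    exact_mod_cast Nat.choose_le_two_pow _ _
  exact mul_le_one₀ h1 (by positivity) h2

lemma kp_rec (m n : ℕ) : kp (m+2) (n+1) = 2 * kp (m+1) (n+1) - kp m n := by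
  rcases lt_or_ge n m with h | h
  · rw [kp_lt h, kp_lt (by omega), kp_lt (by omega)]; norm_num
  rcases Nat.eq_zero_or_pos n with rfl | hn
  · obtain rfl : m = 0 := by omega
    norm_num [kp]
  obtain ⟨j, rfl⟩ := Nat.exists_eq_add_of_le h
  unfold kp
  rw [if_neg (by omega), if_neg (by omega), if_neg (by omega)]
  rw [show 2 * (m + j + 1) - (m+2) = m + 2*j by omega,
    show 2 * (m + j + 1) - (m+1) = m + 2*j + 1 by omega,
    show 2 * (m + j) - m = m + 2*j by omega]
  have e1 : ((m+2*j+1).choose (m+j+1) : ℝ) * (m+j+1) = (m+2*j+1) * (m+2*j).choose (m+j) := by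
    exact_mod_cast (Nat.add_one_mul_choose_eq (m+2*j) (m+j)).symm
  have e2 : ((m+2*j).choose (m+j+1) : ℝ) * (m+j+1) = (m+2*j).choose (m+j) * j := by
    have := Nat.choose_succ_right_eq (m+2*j) (m+j)
    rw [show m + 2*j - (m+j) = j by omega] at this
    exact_mod_cast this
  have hN : (m + 2 * j : ℝ) ≠ 0 := by
    have : 0 < m + 2 * j := by omega
    exact_mod_cast this.ne'
  have hN1 : (m + 2 * j + 1 : ℝ) ≠ 0 := by positivity
  have hn1 : (m + j + 1 : ℝ) ≠ 0 := by positivity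
  rw [← eq_div_iff hn1] at e1 e2
  push_cast
  rw [e1, e2, pow_succ]
  field_simp
  ring

lemma kp_summable {z : ℂ} (hz : ‖z‖ < 1) (m : ℕ) : Summable (fun n => (kp m n : ℂ) * z ^ n) := by
  apply Summable.of_norm_bounded (summable_geometric_of_lt_one (norm_nonneg z) hz)
  intro n
  rw [norm_mul, norm_pow, Complex.norm_real, Real.norm_of_nonneg (kp_nonneg _ _)]
  exact mul_le_of_le_one_left (by positivity) (kp_le_one _ _)

lemma kS_bound {z : ℂ} (hz : ‖z‖ < 1) (m : ℕ) :
    ‖∑' n, (kp m n : ℂ) * z ^ n‖ ≤ (1 - ‖z‖)⁻¹ := by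
  apply tsum_of_norm_bounded (hasSum_geometric_of_lt_one (norm_nonneg z) hz)
  intro n
  rw [norm_mul, norm_pow, Complex.norm_real, Real.norm_of_nonneg (kp_nonneg _ _)]
  exact mul_le_of_le_one_left (by positivity) (kp_le_one _ _)

lemma kS_rec {z : ℂ} (hz : ‖z‖ < 1) (m : ℕ) :
    ∑' n, (kp (m+2) n : ℂ) * z ^ n =
      2 * ∑' n, (kp (m+1) n : ℂ) * z ^ n - z * ∑' n, (kp m n : ℂ) * z ^ n := by
  rw [(kp_summable hz (m+2)).tsum_eq_zero_add, (kp_summable hz (m+1)).tsum_eq_zero_add,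
    kp_succ_zero, kp_succ_zero]
  have h1 := (summable_nat_add_iff 1).2 (kp_summable hz (m+1))
  have h0 := kp_summable hz m
  simp only [Complex.ofReal_zero, zero_mul, zero_add]
  rw [← tsum_mul_left, ← tsum_mul_left, ← (h1.mul_left 2).tsum_sub (h0.mul_left z)]
  congr 1; ext n
  rw [kp_rec]; push_cast; ring

lemma kS_eq {z P : ℂ} (hz : ‖z‖ < 1) (hP : ‖P‖ < 1) (hzP : z = P * (2 - P)) (m : ℕ) :
    ∑' n, (kp m n : ℂ) * z ^ n = P ^ m := by
  set S : ℕ → ℂ := fun m => ∑' n, (kp m n : ℂ) * z ^ n with hS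
  have hrec : ∀ m, S (m+2) = 2 * S (m+1) - z * S m := fun m => kS_rec hz m
  have hb : ∀ m, ‖S m‖ ≤ (1 - ‖z‖)⁻¹ := fun m => kS_bound hz m
  have hS0 : S 0 = 1 := by
    simp only [hS]
    rw [(kp_summable hz 0).tsum_eq_zero_add]
    simp [kp_zero_zero, kp_zero_succ]
  have hD : ∀ m, S (m+1) - P * S m = (2 - P) ^ m * (S 1 - P * S 0) := by
    intro m
    induction m with
    | zero => simp
    | succ k ih =>
      rw [pow_succ, mul_right_comm, ← ih, hrec, hzP]; ring
  have hβ : 1 < ‖2 - P‖ := by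
    have := norm_sub_norm_le (2:ℂ) P
    norm_num at this
    linarith
  have hD0 : S 1 - P * S 0 = 0 := by
    by_contra hne
    have ht := (tendsto_pow_atTop_atTop_of_one_lt hβ).atTop_mul_const (norm_pos_iff.2 hne)
    obtain ⟨k, hk⟩ := (ht.eventually_gt_atTop (2 * (1 - ‖z‖)⁻¹)).exists
    rw [← norm_pow, ← norm_mul, ← hD] at hk
    have h1 := norm_sub_le (S (k+1)) (P * S k)
    rw [norm_mul] at h1
    have h2 : ‖P‖ * ‖S k‖ ≤ ‖S k‖ := mul_le_of_le_one_left (norm_nonneg _) hP.le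
    linarith [hb k, hb (k+1)]
  change S m = P ^ m
  induction m with
  | zero => simpa using hS0
  | succ k ih =>
    have := hD k
    rw [hD0, mul_zero, sub_eq_zero, ih] at this
    rw [this]; ring

/-- asymptotics -/
lemma cb_tendsto : Tendsto (fun n : ℕ => Real.sqrt n * (((2*n).choose n : ℝ) / 2 ^ (2*n)))
    atTop (nhds (1 / Real.sqrt Real.pi)) := by
  have h1 := Stirling.tendsto_stirlingSeq_sqrt_pi
  have h2 : Tendsto (fun n : ℕ => Stirling.stirlingSeq (2*n)) atTop (nhds (Real.sqrt Real.pi)) :=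
    h1.comp (tendsto_id.const_mul_atTop' (by norm_num))
  have hpi : Real.sqrt Real.pi ≠ 0 := by positivity
  have h3 := h2.div (h1.pow 2) (by positivity)
  rw [show Real.sqrt Real.pi / Real.sqrt Real.pi ^ 2 = 1 / Real.sqrt Real.pi by field_simp] at h3
  refine h3.congr' ?_
  filter_upwards [eventually_gt_atTop 0] with n hn
  have hn' : (0:ℝ) < n := by exact_mod_cast hn
  simp only [Pi.div_apply, Stirling.stirlingSeq]
  have hc : ((2*n).choose n : ℝ) = (2*n).factorial / (n.factorial * n.factorial) := by
    rw [Nat.cast_choose ℝ (by omega), show 2*n-n = n by omega]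
  rw [hc]
  have hs : Real.sqrt (2 * ((2*n:ℕ):ℝ)) = 2 * Real.sqrt n := by
    push_cast
    rw [show (2 * (2 * n) : ℝ) = 2^2 * n by ring, Real.sqrt_mul (by positivity), Real.sqrt_sq (by norm_num)]
  rw [hs]
  have hf : (n.factorial : ℝ) ≠ 0 := by positivity
  have hsn : Real.sqrt n ≠ 0 := by positivity
  have hs2 : Real.sqrt (2 * n) ^ 2 = 2 * (Real.sqrt n)^2 := by
    rw [Real.sq_sqrt (by positivity), Real.sq_sqrt (by positivity)]
  simp only [div_pow, mul_pow]
  rw [hs2]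
  push_cast
  have he : Real.exp 1 ≠ 0 := by positivity
  simp only [mul_pow, ← pow_mul, mul_comm n 2]
  field_simp

lemma u_tendsto (m : ℕ) :
    Tendsto (fun n : ℕ => Real.sqrt n * (((2*n-m).choose n : ℝ) / 2 ^ (2*n-m)))
    atTop (nhds (1 / Real.sqrt Real.pi)) := by
  induction m with
  | zero => simpa using cb_tendsto
  | succ m ih =>
    have hr : Tendsto (fun n : ℕ => ((2 * n - 2 * m : ℝ) / (2 * n - m))) atTop (nhds 1) := by
      have ha : Tendsto (fun n : ℕ => (m : ℝ) / n) atTop (nhds 0) :=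
        tendsto_const_div_atTop_nhds_zero_nat _
      have hb := ((tendsto_const_nhds (x := (2:ℝ))).sub (ha.const_mul 2)).div
        ((tendsto_const_nhds (x := (2:ℝ))).sub ha) (by norm_num)
      norm_num at hb
      refine hb.congr' ?_
      filter_upwards [eventually_gt_atTop m] with n hn
      have h0 : (n:ℝ) ≠ 0 := by exact_mod_cast (by omega : n ≠ 0)
      have h1 : (2 * n - m : ℝ) ≠ 0 := by
        have : (m:ℝ) < n := by exact_mod_cast hn
        have : (0:ℝ) ≤ m := by positivity
        intro h; linarith
      have h2 : (2 - m / n : ℝ) ≠ 0 := by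
        intro h; apply h1; field_simp at h; linarith
      simp only [Pi.div_apply]
      field_simp
    have := ih.mul hr
    rw [mul_one] at this
    refine this.congr' ?_
    filter_upwards [eventually_gt_atTop m] with n hn
    obtain ⟨j, rfl⟩ := Nat.exists_eq_add_of_lt hn
    rw [show 2 * (m+j+1) - m = (m + 2 * j + 1) + 1 by omega,
      show 2 * (m+j+1) - (m+1) = m + 2 * j + 1 by omega]
    have e : ((m+2*j+1).choose (m+j+1) : ℝ) * (m+2*j+2) = (m+2*j+1+1).choose (m+j+1) * (j+1) := by
      have := Nat.choose_mul_succ_eq (m+2*j+1) (m+j+1)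
      rw [show m + 2*j+1+1 - (m+j+1) = j+1 by omega] at this
      exact_mod_cast this
    have hN : (m + 2*j+2 : ℝ) ≠ 0 := by positivity
    rw [← eq_div_iff hN] at e
    rw [e]
    push_cast
    rw [show (2 * (m + j + 1) - m : ℝ) = m + 2*j+2 by ring, pow_succ]
    field_simp
    ring

lemma u_le (n m : ℕ) (h : m ≤ n) : (((2*n-m).choose n : ℝ) / 2 ^ (2*n-m)) ≤
    ((2*n).choose n : ℝ) / 2 ^ (2*n) := by
  induction m with
  | zero => simp
  | succ m ih =>
    refine le_trans ?_ (ih (by omega))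
    obtain ⟨j, rfl⟩ := Nat.exists_eq_add_of_lt (show m < n by omega)
    rw [show 2 * (m+j+1) - m = (m + 2 * j + 1) + 1 by omega,
      show 2 * (m+j+1) - (m+1) = m + 2 * j + 1 by omega]
    have e : ((m+2*j+1).choose (m+j+1) : ℝ) * (m+2*j+2) = (m+2*j+1+1).choose (m+j+1) * (j+1) := by
      have := Nat.choose_mul_succ_eq (m+2*j+1) (m+j+1)
      rw [show m + 2*j+1+1 - (m+j+1) = j+1 by omega] at this
      exact_mod_cast this
    have hN : (m + 2*j+2 : ℝ) ≠ 0 := by positivity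
    rw [← eq_div_iff hN] at e
    rw [e, pow_succ (2:ℝ) (m+2*j+1), div_le_div_iff₀ (by positivity) (by positivity),
      div_mul_eq_mul_div, div_le_iff₀ (by positivity)]
    have : (0:ℝ) ≤ ((m+2*j+1+1).choose (m+j+1) : ℝ) * 2 ^ (m+2*j+1) * m := by positivity
    nlinarith

lemma kp_asymp (m : ℕ) : Tendsto (fun n : ℕ => (n * Real.sqrt n) * kp m n) atTop
    (nhds (m / 2 * (1 / Real.sqrt Real.pi))) := by
  have ha : Tendsto (fun n : ℕ => (m : ℝ) / n) atTop (nhds 0) :=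
    tendsto_const_div_atTop_nhds_zero_nat _
  have hb := (tendsto_const_nhds (x := (m:ℝ))).div
        ((tendsto_const_nhds (x := (2:ℝ))).sub ha) (by norm_num)
  have := hb.mul (u_tendsto m)
  rw [sub_zero] at this
  refine this.congr' ?_
  filter_upwards [eventually_gt_atTop m] with n hn
  unfold kp
  rw [if_neg (by omega)]
  have h0 : (n:ℝ) ≠ 0 := by exact_mod_cast (by omega : n ≠ 0)
  have h1 : (2 * n - m : ℝ) ≠ 0 := by
    have : (m:ℝ) < n := by exact_mod_cast hn
    have : (0:ℝ) ≤ m := by positivity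
    intro h; linarith
  have h2 : (2 - m / n : ℝ) ≠ 0 := by
    intro h; apply h1; field_simp at h; linarith
  have hc : ((2 * n - m : ℕ) : ℝ) = 2 * n - m := by
    rw [Nat.cast_sub (by omega)]; push_cast; ring
  simp only [Pi.div_apply]
  rw [hc]
  rw [show (m : ℝ) / (2 - m / n) = n * (m / (2 * n - m)) by field_simp]
  ring

lemma kp_dom : ∃ K : ℝ, ∀ m n : ℕ, (n * Real.sqrt n) * kp m n ≤ K * m := by
  obtain ⟨K, hK⟩ := cb_tendsto.bddAbove_range
  have hK' : ∀ n : ℕ, Real.sqrt n * (((2*n).choose n : ℝ) / 2 ^ (2*n)) ≤ K :=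
    fun n => hK ⟨n, rfl⟩
  have hK0 : 0 ≤ K := le_trans (by positivity) (hK' 0)
  refine ⟨K, fun m n => ?_⟩
  rcases lt_or_ge n m with h | h
  · rw [kp_lt h]; simp; positivity
  rcases Nat.eq_zero_or_pos n with rfl | hn
  · simp; positivity
  unfold kp
  rw [if_neg (by omega)]
  have hpos : (0:ℝ) < ((2 * n - m : ℕ) : ℝ) := by exact_mod_cast (by omega : 0 < 2 * n - m)
  have h1 : (n:ℝ) / ((2 * n - m : ℕ) : ℝ) ≤ 1 := by
    apply div_le_one_of_le₀ _ hpos.le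
    exact_mod_cast (by omega : n ≤ 2 * n - m)
  calc _ = ((n:ℝ) / ((2 * n - m : ℕ) : ℝ)) * m * (Real.sqrt n * (((2 * n - m).choose n : ℝ) / 2 ^ (2 * n - m))) := by ring
    _ ≤ 1 * m * K := by
      gcongr
      exact le_trans (mul_le_mul_of_nonneg_left (u_le n m h) (Real.sqrt_nonneg _)) (hK' n)
    _ = K * m := by ring

lemma hasSum_conv {R : Type*} [AddCommMonoid R] [TopologicalSpace R] {f g : ℕ → R} {a b : R}
    (h : HasSum f a) (h1 : ∀ n, g n = f n) (h2 : b = a) : HasSum g b := by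
  rw [h2, funext h1]; exact h

noncomputable def kA (q : ℝ) (n : ℕ) : ℝ := ∑' m : ℕ, ((m : ℝ) + 1) * q ^ m * kp m n

lemma kq_hasSum {q : ℂ} (hq : ‖q‖ < 1) :
    HasSum (fun m : ℕ => ((m : ℂ) + 1) * q ^ m) (1 / (1 - q) ^ 2) := by
  have := hasSum_choose_mul_geometric_of_norm_lt_one 1 hq
  simpa using this

lemma kq_summable {q : ℝ} (h0 : 0 ≤ q) (hq : q < 1) :
    Summable (fun m : ℕ => ((m : ℝ) + 1) * q ^ m) := by
  have := summable_choose_mul_geometric_of_norm_lt_one (R := ℝ) 1 (r := q)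
    (by rwa [Real.norm_of_nonneg h0])
  simpa using this

lemma kA_asymp {q : ℝ} (h0 : 0 ≤ q) (hq : q < 1) :
    Tendsto (fun n : ℕ => (n * Real.sqrt n) * kA q n) atTop
      (nhds (q / (1 - q) ^ 3 * (1 / Real.sqrt Real.pi))) := by
  have hqn : ‖q‖ < 1 := by rwa [Real.norm_of_nonneg h0]
  obtain ⟨K, hK⟩ := kp_dom
  have hs : HasSum (fun m : ℕ => ((m : ℝ) + 1) * m * q ^ m) (2 * q / (1 - q) ^ 3) := by
    have h := (hasSum_choose_mul_geometric_of_norm_lt_one 2 hqn).mul_left (2 * q)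
    rw [← hasSum_nat_add_iff' 1]
    refine hasSum_conv h (fun m => ?_) ?_
    · have : (((m + 2).choose 2 : ℕ) : ℝ) = (m + 2) * (m + 1) / 2 := by
        rw [Nat.cast_choose_two]; push_cast; ring
      rw [this]; push_cast; ring
    · simp; ring
  have hlim : ∑' m : ℕ, ((m : ℝ) + 1) * q ^ m * (m / 2 * (1 / Real.sqrt Real.pi)) =
      q / (1 - q) ^ 3 * (1 / Real.sqrt Real.pi) := by
    have := (hs.mul_right (1 / 2 * (1 / Real.sqrt Real.pi))).tsum_eq
    rw [show q / (1 - q) ^ 3 * (1 / Real.sqrt Real.pi) =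
      2 * q / (1 - q) ^ 3 * (1 / 2 * (1 / Real.sqrt Real.pi)) by ring, ← this]
    congr 1; ext m; ring
  rw [← hlim]
  have key := tendsto_tsum_of_dominated_convergence (𝓕 := atTop)
    (f := fun (n : ℕ) (m : ℕ) => ((m : ℝ) + 1) * q ^ m * ((n * Real.sqrt n) * kp m n))
    (g := fun m : ℕ => ((m : ℝ) + 1) * q ^ m * (m / 2 * (1 / Real.sqrt Real.pi)))
    (bound := fun m : ℕ => ((m : ℝ) + 1) * m * q ^ m * K) (hs.summable.mul_right K)
    (fun m => (kp_asymp m).const_mul _)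
    (Eventually.of_forall fun n m => by
      have hp := kp_nonneg m n
      rw [Real.norm_of_nonneg (by positivity)]
      calc _ ≤ ((m : ℝ) + 1) * q ^ m * (K * m) :=
            mul_le_mul_of_nonneg_left (hK m n) (by positivity)
        _ = _ := by ring)
  refine key.congr fun n => ?_
  rw [kA, ← tsum_mul_left]
  congr 1; ext m; ring

lemma kA_hasSum {q : ℝ} (h0 : 0 ≤ q) (hq : q < 1) {z P : ℂ} (hz : ‖z‖ < 1) (hP : ‖P‖ < 1)
    (hzP : z = P * (2 - P)) :
    HasSum (fun n : ℕ => (kA q n : ℂ) * z ^ n) (1 / (1 - q * P) ^ 2) := by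
  have hsum : Summable (fun x : ℕ × ℕ => (((x.1 : ℂ) + 1) * q ^ x.1) * ((kp x.1 x.2 : ℂ) * z ^ x.2)) := by
    have h1 := (kq_summable h0 hq).mul_of_nonneg
      (summable_geometric_of_lt_one (norm_nonneg z) hz) (fun m => by positivity)
      (fun n => by positivity)
    apply Summable.of_norm_bounded h1
    rintro ⟨m, n⟩
    have e : ‖((m : ℂ) + 1) * (q : ℂ) ^ m‖ = (m + 1) * q ^ m := by
      have : ((m : ℂ) + 1) * (q : ℂ) ^ m = (((m + 1) * q ^ m : ℝ) : ℂ) := by push_cast; ring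
      rw [this, Complex.norm_real, Real.norm_of_nonneg (by positivity)]
    simp only
    rw [norm_mul, e, norm_mul, norm_pow, Complex.norm_real, Real.norm_of_nonneg (kp_nonneg _ _)]
    exact mul_le_mul_of_nonneg_left (mul_le_of_le_one_left (by positivity) (kp_le_one _ _))
      (by positivity)
  have hqP : ‖(q : ℂ) * P‖ < 1 := by
    rw [norm_mul, Complex.norm_real, Real.norm_of_nonneg h0]
    nlinarith [norm_nonneg P]
  have hfib : ∀ m : ℕ, HasSum (fun n : ℕ => (((m : ℂ) + 1) * q ^ m) * ((kp m n : ℂ) * z ^ n))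
      ((((m : ℂ) + 1) * q ^ m) * P ^ m) := by
    intro m
    apply HasSum.mul_left
    rw [← kS_eq hz hP hzP m]
    exact (kp_summable hz m).hasSum
  have h2 := hsum.hasSum.prod_fiberwise hfib
  have h3 := kq_hasSum hqP
  have h4 := h2.unique (a₂ := 1 / (1 - q * P) ^ 2) (by
    exact hasSum_conv h3 (fun m => by rw [mul_pow]; ring) rfl)
  have h5 : HasSum (fun x : ℕ × ℕ => (((x.2 : ℂ) + 1) * q ^ x.2) * ((kp x.2 x.1 : ℂ) * z ^ x.1))
      (1 / (1 - q * P) ^ 2) := by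
    rw [← h4]
    exact (Equiv.prodComm ℕ ℕ).hasSum_iff.2 hsum.hasSum
  refine h5.prod_fiberwise fun n => ?_
  have hs : Summable (fun m : ℕ => ((m : ℝ) + 1) * q ^ m * kp m n) := by
    apply Summable.of_nonneg_of_le _ _ (kq_summable h0 hq)
    · intro m
      have := kp_nonneg m n
      positivity
    · intro m
      exact mul_le_of_le_one_right (by positivity) (kp_le_one m n)
  have h6 := (Complex.hasSum_ofReal.2 hs.hasSum).mul_right (z ^ n)
  exact hasSum_conv h6 (fun m => by push_cast; ring) rfl

lemma k_iter {f : ℂ → ℂ} {a : ℕ → ℂ} (h : ∀ᶠ z in nhds (0:ℂ), HasSum (fun k => a k * z ^ k) (f z))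
    (k : ℕ) : iteratedDeriv k f 0 / (Nat.factorial k : ℂ) = a k := by
  have h1 : HasFPowerSeriesAt f (FormalMultilinearSeries.ofScalars ℂ a) 0 := by
    rw [hasFPowerSeriesAt_iff]
    filter_upwards [h] with z hz
    simpa [FormalMultilinearSeries.coeff_ofScalars, mul_comm] using hz
  obtain ⟨r, hr⟩ := h1
  have := hr.factorial_smul (1:ℂ) k
  rw [iteratedDeriv_eq_iteratedFDeriv, ← this]
  have hf : (Nat.factorial k : ℂ) ≠ 0 := by exact_mod_cast Nat.factorial_ne_zero k
  simp [FormalMultilinearSeries.ofScalars, hf]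

lemma k_series {c : ℝ} (hc : 0 < c) : ∀ᶠ z in nhds (0:ℂ),
    HasSum (fun k : ℕ => (((if k = 0 then 0 else (1 + c)⁻¹ ^ 2 * kA (c / (1 + c)) (k - 1) : ℝ)) : ℂ) * z ^ k)
      (z / (1 + (c : ℂ) * (1 - z) ^ ((1 : ℂ) / 2)) ^ 2) := by
  have hcont : ContinuousAt (fun z : ℂ => ‖1 - (1 - z) ^ ((1 : ℂ) / 2)‖) 0 := by
    refine (continuousAt_const.sub (ContinuousAt.cpow ?_ continuousAt_const ?_)).norm
    · fun_prop
    · simp [Complex.slitPlane]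
  have h1 : ∀ᶠ z in nhds (0:ℂ), ‖1 - (1 - z) ^ ((1 : ℂ) / 2)‖ < 1 := by
    apply hcont.eventually_lt continuousAt_const
    simp
  have h2 : ∀ᶠ z in nhds (0:ℂ), ‖z‖ < 1 := by
    apply (continuous_norm.continuousAt).eventually_lt continuousAt_const
    simp
  filter_upwards [h1, h2] with z hP hz
  set w := (1 - z) ^ ((1 : ℂ) / 2) with hw
  have hw2 : w ^ 2 = 1 - z := by
    have := Complex.cpow_nat_inv_pow (1 - z) (two_ne_zero)
    rw [hw, one_div]; exact_mod_cast this
  have hq0 : 0 ≤ c / (1 + c) := by positivity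
  have hq1 : c / (1 + c) < 1 := by rw [div_lt_one (by positivity)]; linarith
  have hA := kA_hasSum hq0 hq1 hz hP (by linear_combination hw2)
  have hB := hA.mul_left (z * ((1 + c)⁻¹ : ℂ) ^ 2)
  rw [← hasSum_nat_add_iff' 1]
  have hc1 : (1 + c : ℂ) ≠ 0 := by
    exact_mod_cast (by positivity : (1 + c : ℝ) ≠ 0)
  refine hasSum_conv hB (fun n => ?_) ?_
  · simp only [Nat.add_eq_zero_iff, one_ne_zero, and_false, if_false, Nat.add_sub_cancel]
    push_cast; ring
  · simp only [Finset.range_one, Finset.sum_singleton, if_true, Complex.ofReal_zero, zero_mul,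
      sub_zero]
    push_cast
    rw [show (1 : ℂ) - c / (1 + c) * (1 - w) = (1 + c * w) / (1 + c) by field_simp; ring]
    rw [div_pow, inv_pow]
    field_simp

/-- Tail asymptotics for the number of killed particles in the Moranian case: the Taylor
coefficients `a_k` of `F(s) = s (1 + (y/√6)√(1−s))⁻²` at `0` satisfy
`k^{3/2} a_k → y/√(6π)`. -/
theorem killed_tail_asymptotics (y : ℝ) (hy : 0 < y) :
    Tendsto
      (fun k : ℕ => (((k : ℝ) ^ ((3 : ℝ) / 2) : ℝ) : ℂ) *
        (iteratedDeriv k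
            (fun z : ℂ => z / (1 + ((y / Real.sqrt 6 : ℝ) : ℂ) * (1 - z) ^ ((1 : ℂ) / 2)) ^ 2) 0 /
          (Nat.factorial k : ℂ)))
      atTop (nhds (((y / Real.sqrt (6 * Real.pi) : ℝ) : ℂ))) := by
  have hc : 0 < y / Real.sqrt 6 := by positivity
  have hlim : y / Real.sqrt (6 * Real.pi) = y / Real.sqrt 6 * (1 / Real.sqrt Real.pi) := by
    rw [Real.sqrt_mul (by norm_num)]; field_simp
  rw [hlim]
  generalize y / Real.sqrt 6 = c at hc
  simp only [k_iter (k_series hc)]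
  simp only [← Complex.ofReal_mul]
  refine (Complex.continuous_ofReal.tendsto _).comp ?_
  rw [← tendsto_add_atTop_iff_nat 1]
  have hq0 : 0 ≤ c / (1 + c) := by positivity
  have hq1 : c / (1 + c) < 1 := by rw [div_lt_one (by positivity)]; linarith
  have hA := (kA_asymp hq0 hq1).const_mul ((1 + c)⁻¹ ^ 2)
  have hr : Tendsto (fun n : ℕ => (1 + 1 / (n : ℝ)) ^ ((3 : ℝ) / 2)) atTop (nhds 1) := by
    have h := (tendsto_const_nhds (x := (1:ℝ))).add tendsto_one_div_atTop_nhds_zero_nat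
    have h' := h.rpow_const (p := (3:ℝ)/2) (by norm_num)
    simpa using h'
  have hm := hr.mul hA
  have hL : 1 * ((1 + c)⁻¹ ^ 2 * (c / (1 + c) / (1 - c / (1 + c)) ^ 3 * (1 / Real.sqrt Real.pi))) =
      c * (1 / Real.sqrt Real.pi) := by
    have h1c : (1 + c) ≠ 0 := by positivity
    rw [show 1 - c / (1 + c) = 1 / (1 + c) by field_simp; ring]
    field_simp
  rw [hL] at hm
  refine hm.congr' ?_
  filter_upwards [eventually_gt_atTop 0] with n hn
  have hn' : (0:ℝ) < n := by exact_mod_cast hn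
  simp only [Nat.add_eq_zero_iff, one_ne_zero, and_false, if_false, Nat.add_sub_cancel]
  have e1 : (n : ℝ) * Real.sqrt n = (n : ℝ) ^ ((3 : ℝ) / 2) := by
    rw [show (3:ℝ)/2 = 1 + 1/2 by norm_num, Real.rpow_add hn', Real.rpow_one, Real.sqrt_eq_rpow]
  have e2 : ((n + 1 : ℕ) : ℝ) ^ ((3 : ℝ) / 2) =
      (1 + 1 / (n : ℝ)) ^ ((3 : ℝ) / 2) * (n : ℝ) ^ ((3 : ℝ) / 2) := by
    rw [← Real.mul_rpow (by positivity) hn'.le]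
    congr 1
    push_cast; field_simp
  rw [e1, e2]; ring
end

section
/- Let y > 0 and let φ(s) = 1 − 6(1−s)/(y·√(1−s) + √6)² (principal branch of the square root), analytic on the open unit disk. Then the Taylor coefficients p_k of φ at s = 0 satisfy lim_{k→∞} k^{5/2}·p_k = 3y/(2√(6π)). -/
open Filter

noncomputable def qq (c : ℝ) (k : ℕ) : ℝ :=
  ∫ u : ℝ, u ^ 4 / (1 + c ^ 2 * u ^ 2) ^ 2 * ((1 + u ^ 2)⁻¹) ^ (k + 1)

lemma h_bound (c : ℝ) (hc : 0 < c) (u : ℝ) : u ^ 4 / (1 + c ^ 2 * u ^ 2) ^ 2 ≤ 1 / c ^ 4 := by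
  rw [div_le_div_iff₀ (by positivity) (by positivity)]
  have : 0 ≤ c ^ 2 * u ^ 2 := by positivity
  nlinarith

lemma base_int (c : ℝ) (hc : 0 < c) :
    MeasureTheory.Integrable (fun u : ℝ => u ^ 4 / (1 + c ^ 2 * u ^ 2) ^ 2 * (1 + u ^ 2)⁻¹) := by
  refine (integrable_inv_one_add_sq.const_mul (1 / c ^ 4)).mono' ?_ ?_
  · exact Measurable.aestronglyMeasurable (by fun_prop)
  · refine Eventually.of_forall fun u => ?_
    rw [Real.norm_of_nonneg (by positivity)]
    exact mul_le_mul_of_nonneg_right (h_bound c hc u) (by positivity)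

lemma term_le (c : ℝ) (k : ℕ) (u : ℝ) :
    u ^ 4 / (1 + c ^ 2 * u ^ 2) ^ 2 * ((1 + u ^ 2)⁻¹) ^ (k + 1) ≤
      u ^ 4 / (1 + c ^ 2 * u ^ 2) ^ 2 * (1 + u ^ 2)⁻¹ := by
  gcongr
  have h1 : (1 + u ^ 2)⁻¹ ≤ 1 := inv_le_one_of_one_le₀ (by nlinarith [sq_nonneg u])
  rw [pow_succ]
  exact mul_le_of_le_one_left (by positivity) (pow_le_one₀ (by positivity) h1)

lemma term_int (c : ℝ) (hc : 0 < c) (k : ℕ) :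
    MeasureTheory.Integrable
      (fun u : ℝ => u ^ 4 / (1 + c ^ 2 * u ^ 2) ^ 2 * ((1 + u ^ 2)⁻¹) ^ (k + 1)) := by
  refine (base_int c hc).mono' ?_ ?_
  · exact Measurable.aestronglyMeasurable (by fun_prop)
  · refine Eventually.of_forall fun u => ?_
    rw [Real.norm_of_nonneg (by positivity)]
    exact term_le c k u

lemma qq_nonneg (c : ℝ) (k : ℕ) : 0 ≤ qq c k :=
  MeasureTheory.integral_nonneg fun u => by positivity

lemma qq_le (c : ℝ) (hc : 0 < c) (k : ℕ) : qq c k ≤ qq c 0 :=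
  MeasureTheory.integral_mono (term_int c hc k) (term_int c hc 0) fun u => by
    simpa using term_le c k u

lemma qq_hasSum (c : ℝ) (hc : 0 < c) (z : ℝ) (hz : |z| < 1) :
    HasSum (fun k => qq c k * z ^ k)
      (∫ u : ℝ, u ^ 4 / (1 + c ^ 2 * u ^ 2) ^ 2 * (u ^ 2 + (1 - z))⁻¹) := by
  have key := MeasureTheory.hasSum_integral_of_summable_integral_norm
    (F := fun (k : ℕ) (u : ℝ) =>
      u ^ 4 / (1 + c ^ 2 * u ^ 2) ^ 2 * ((1 + u ^ 2)⁻¹) ^ (k + 1) * z ^ k)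
    (μ := MeasureTheory.volume) (fun k => (term_int c hc k).mul_const _) ?_
  · simp only [MeasureTheory.integral_mul_const] at key
    convert! key using 2
    ext u
    have h0 : (0:ℝ) < 1 + u ^ 2 := by positivity
    have h2 : |(1 + u ^ 2)⁻¹ * z| < 1 := by
      rw [abs_mul, abs_of_pos (by positivity)]
      have h1 : (1 + u ^ 2)⁻¹ ≤ 1 := inv_le_one_of_one_le₀ (by nlinarith [sq_nonneg u])
      calc _ ≤ 1 * |z| := by gcongr
        _ < 1 := by simpa using hz
    have h3 := (hasSum_geometric_of_abs_lt_one h2).mul_left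
      (u ^ 4 / (1 + c ^ 2 * u ^ 2) ^ 2 * (1 + u ^ 2)⁻¹)
    have h4 := h3.tsum_eq
    have hzz := abs_lt.1 hz
    have e : (u ^ 2 + (1 - z))⁻¹ = (1 + u ^ 2)⁻¹ * (1 - (1 + u ^ 2)⁻¹ * z)⁻¹ := by
      rw [← mul_inv]
      congr 1
      field_simp
      ring
    rw [e, ← mul_assoc, ← h4]
    congr 1
    ext k
    rw [mul_pow, pow_succ]
    ring
  · have e : ∀ k : ℕ, (∫ u : ℝ, ‖u ^ 4 / (1 + c ^ 2 * u ^ 2) ^ 2 * ((1 + u ^ 2)⁻¹) ^ (k + 1) * z ^ k‖)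
        = qq c k * |z| ^ k := by
      intro k
      rw [qq, ← MeasureTheory.integral_mul_const]
      congr 1
      ext u
      rw [norm_mul, Real.norm_of_nonneg (by positivity), norm_pow, Real.norm_eq_abs]
    simp only [e]
    refine Summable.of_nonneg_of_le (fun k => mul_nonneg (qq_nonneg c k) (by positivity))
      (fun k => ?_) ((summable_geometric_of_lt_one (abs_nonneg z) hz).mul_left (qq c 0))
    gcongr
    exact qq_le c hc k

lemma int_inv_sq : MeasureTheory.Integrable (fun x : ℝ => ((1 + x ^ 2)⁻¹) ^ 2) ∧
    ∫ x : ℝ, ((1 + x ^ 2)⁻¹) ^ 2 = Real.pi / 2 := by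
  have hint : MeasureTheory.Integrable (fun x : ℝ => ((1 + x ^ 2)⁻¹) ^ 2) := by
    refine integrable_inv_one_add_sq.mono' ?_ ?_
    · exact Measurable.aestronglyMeasurable (by fun_prop)
    · refine Eventually.of_forall fun u => ?_
      rw [Real.norm_of_nonneg (by positivity)]
      have h1 : (1 + u ^ 2)⁻¹ ≤ 1 := inv_le_one_of_one_le₀ (by nlinarith [sq_nonneg u])
      rw [sq]
      exact mul_le_of_le_one_left (by positivity) h1
  refine ⟨hint, ?_⟩
  have hsmall : ∀ x : ℝ, |x * (1 + x ^ 2)⁻¹| ≤ |x|⁻¹ := by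
    intro x
    rcases eq_or_ne x 0 with rfl | hx
    · simp
    · have := abs_pos.2 hx
      rw [abs_mul, abs_of_pos (a := (1 + x ^ 2)⁻¹) (by positivity), ← div_eq_mul_inv,
        div_le_iff₀ (by positivity)]
      field_simp
      rw [sq_abs]; linarith
  have lt : Tendsto (fun x : ℝ => x * (1 + x ^ 2)⁻¹) atTop (nhds 0) :=
    squeeze_zero_norm hsmall (tendsto_inv_atTop_zero.comp tendsto_abs_atTop_atTop)
  have lb : Tendsto (fun x : ℝ => x * (1 + x ^ 2)⁻¹) atBot (nhds 0) :=
    squeeze_zero_norm hsmall (tendsto_inv_atTop_zero.comp tendsto_abs_atBot_atTop)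
  have h := MeasureTheory.integral_of_hasDerivAt_of_tendsto
    (f := fun x : ℝ => x * (1 + x ^ 2)⁻¹)
    (f' := fun x : ℝ => 2 * ((1 + x ^ 2)⁻¹) ^ 2 - (1 + x ^ 2)⁻¹) ?_
    ((hint.const_mul 2).sub integrable_inv_one_add_sq) lb lt
  · rw [MeasureTheory.integral_sub (hint.const_mul 2) integrable_inv_one_add_sq,
      MeasureTheory.integral_const_mul, integral_univ_inv_one_add_sq] at h
    linarith
  · intro x
    have h0 : (1 + x ^ 2) ≠ 0 := by positivity
    have := (hasDerivAt_id x).mul ((((hasDerivAt_id x).pow 2).const_add 1).inv h0)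
    convert! this using 1
    simp
    field_simp
    ring

lemma int_eval (c w : ℝ) (hc : 0 < c) (hw : 0 < w) (hcw : c * w ≠ 1) :
    ∫ u : ℝ, u ^ 4 / (1 + c ^ 2 * u ^ 2) ^ 2 * (u ^ 2 + w ^ 2)⁻¹ =
      Real.pi / (2 * c) * (1 / c ^ 2 - w ^ 2 / (1 + c * w) ^ 2) := by
  have hd : 1 - c ^ 2 * w ^ 2 ≠ 0 := by
    have : 1 - c ^ 2 * w ^ 2 = (1 - c * w) * (1 + c * w) := by ring
    rw [this]
    exact mul_ne_zero (sub_ne_zero.2 (Ne.symm hcw)) (by positivity)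
  have i1 : MeasureTheory.Integrable (fun u : ℝ => (1 + (w⁻¹ * u) ^ 2)⁻¹) :=
    integrable_inv_one_add_sq.comp_mul_left' (by positivity)
  have i2 : MeasureTheory.Integrable (fun u : ℝ => (1 + (c * u) ^ 2)⁻¹) :=
    integrable_inv_one_add_sq.comp_mul_left' (by positivity)
  have i3 : MeasureTheory.Integrable (fun u : ℝ => ((1 + (c * u) ^ 2)⁻¹) ^ 2) :=
    int_inv_sq.1.comp_mul_left' (R := c) (by positivity)
  have e1 := MeasureTheory.Measure.integral_comp_mul_left (fun x : ℝ => (1 + x ^ 2)⁻¹) w⁻¹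
  have e2 := MeasureTheory.Measure.integral_comp_mul_left (fun x : ℝ => (1 + x ^ 2)⁻¹) c
  have e3 := MeasureTheory.Measure.integral_comp_mul_left (fun x : ℝ => ((1 + x ^ 2)⁻¹) ^ 2) c
  rw [integral_univ_inv_one_add_sq, inv_inv, abs_of_pos hw, smul_eq_mul] at e1
  rw [integral_univ_inv_one_add_sq, abs_of_pos (by positivity), smul_eq_mul] at e2
  rw [int_inv_sq.2, abs_of_pos (by positivity), smul_eq_mul] at e3
  have pf : ∀ u : ℝ, u ^ 4 / (1 + c ^ 2 * u ^ 2) ^ 2 * (u ^ 2 + w ^ 2)⁻¹ =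
      (w ^ 2 / (1 - c ^ 2 * w ^ 2) ^ 2) * (1 + (w⁻¹ * u) ^ 2)⁻¹ +
      (c ^ 2 * (1 / c ^ 4 - w ^ 4 / (1 - c ^ 2 * w ^ 2) ^ 2)) * (1 + (c * u) ^ 2)⁻¹ +
      (- 1 / (c ^ 2 * (1 - c ^ 2 * w ^ 2))) * ((1 + (c * u) ^ 2)⁻¹) ^ 2 := by
    intro u
    have a1 : 1 + c ^ 2 * u ^ 2 ≠ 0 := by positivity
    have a2 : u ^ 2 + w ^ 2 ≠ 0 := by positivity
    have a3 : (1 + (w⁻¹ * u) ^ 2)⁻¹ = w ^ 2 / (u ^ 2 + w ^ 2) := by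
      rw [inv_eq_one_div, div_eq_div_iff (by positivity) a2]
      field_simp
      ring
    rw [a3, mul_pow c u]
    field_simp
    ring
  simp only [pf]
  have i12 : MeasureTheory.Integrable (fun u : ℝ =>
      (w ^ 2 / (1 - c ^ 2 * w ^ 2) ^ 2) * (1 + (w⁻¹ * u) ^ 2)⁻¹ +
      (c ^ 2 * (1 / c ^ 4 - w ^ 4 / (1 - c ^ 2 * w ^ 2) ^ 2)) * (1 + (c * u) ^ 2)⁻¹) :=
    (i1.const_mul _).add (i2.const_mul _)
  rw [MeasureTheory.integral_add i12 (i3.const_mul _),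
    MeasureTheory.integral_add (i1.const_mul _) (i2.const_mul _),
    MeasureTheory.integral_const_mul, MeasureTheory.integral_const_mul,
    MeasureTheory.integral_const_mul, e1, e2, e3]
  have hd1 : 1 - c * w ≠ 0 := sub_ne_zero.2 (Ne.symm hcw)
  have hd2 : 1 + c * w ≠ 0 := by positivity
  have hd3 : 1 - w * c ≠ 0 := by rwa [mul_comm]
  have hd4 : 1 + w * c ≠ 0 := by positivity
  have : 1 - c ^ 2 * w ^ 2 = (1 - c * w) * (1 + c * w) := by ring
  rw [this]
  field_simp
  ring

lemma gauss4 : ∫ x : ℝ, x ^ 4 * Real.exp (-x ^ 2) = 3 * √Real.pi / 4 := by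
  have h := integral_comp_abs (f := fun x : ℝ => x ^ 4 * Real.exp (-x ^ 2))
  have e : ∀ x : ℝ, |x| ^ 4 = x ^ 4 := fun x => by
    rw [show 4 = 2 * 2 from rfl, pow_mul, sq_abs, ← pow_mul]
  simp only [sq_abs, e] at h
  rw [h]
  have g := integral_rpow_mul_exp_neg_rpow (p := 2) (q := 4) (by norm_num) (by norm_num)
  have : ∀ x : ℝ, x ^ (4 : ℝ) * Real.exp (-x ^ (2 : ℝ)) = x ^ 4 * Real.exp (-x ^ 2) := by
    intro x
    norm_cast
  simp only [this] at g
  rw [g, show ((4:ℝ) + 1) / 2 = (1 / 2 + 1) + 1 by norm_num, Real.Gamma_add_one (by norm_num),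
    Real.Gamma_add_one (by norm_num), Real.Gamma_one_half_eq]
  ring

lemma scaled (c : ℝ) (n : ℕ) (hn : 0 < n) : (n : ℝ) ^ ((5 : ℝ) / 2) * qq c n =
    ∫ x : ℝ, x ^ 4 / (1 + c ^ 2 * (x ^ 2 / n)) ^ 2 * ((1 + x ^ 2 / n)⁻¹) ^ (n + 1) := by
  have hn' : (0:ℝ) < n := by exact_mod_cast hn
  have hs : 0 < √(n:ℝ) := Real.sqrt_pos.2 hn'
  have hss : √(n:ℝ) ^ 2 = n := Real.sq_sqrt hn'.le
  have e := MeasureTheory.Measure.integral_comp_mul_left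
    (fun u : ℝ => u ^ 4 / (1 + c ^ 2 * u ^ 2) ^ 2 * ((1 + u ^ 2)⁻¹) ^ (n + 1)) (√(n:ℝ))⁻¹
  rw [inv_inv, abs_of_pos hs, smul_eq_mul] at e
  have e2 : (n : ℝ) ^ ((5 : ℝ) / 2) = n ^ 2 * √(n:ℝ) := by
    rw [Real.sqrt_eq_rpow, ← Real.rpow_natCast, ← Real.rpow_add hn']
    norm_num
  rw [e2, mul_assoc, qq, ← e, ← MeasureTheory.integral_const_mul]
  congr 1
  ext x
  have h2 : ((√(n:ℝ))⁻¹ * x) ^ 2 = x ^ 2 / n := by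
    rw [mul_pow, inv_pow, hss]; field_simp
  have h4 : ((√(n:ℝ))⁻¹ * x) ^ 4 = x ^ 4 / n ^ 2 := by
    rw [show 4 = 2 * 2 from rfl, pow_mul, h2, div_pow, ← pow_mul]
  rw [h2, h4]
  field_simp

lemma dom (x : ℝ) (n : ℕ) (hn : 3 ≤ n) :
    x ^ 4 * ((1 + x ^ 2 / n)⁻¹) ^ (n + 1) ≤ 27 * (1 + x ^ 2)⁻¹ := by
  have hn3 : (3:ℝ) ≤ n := by exact_mod_cast hn
  have hn' : (0:ℝ) < n := by linarith
  have hx : 0 ≤ x ^ 2 / n := by positivity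
  have h1 := one_add_mul_self_le_rpow_one_add (s := x ^ 2 / n) (by linarith) (p := n / 3)
    (by linarith)
  have h1' : 1 + x ^ 2 / 3 ≤ (1 + x ^ 2 / n) ^ ((n:ℝ) / 3) := by
    convert h1 using 2
    field_simp
  have h2 : (1 + x ^ 2 / 3) ^ 3 ≤ (1 + x ^ 2 / n) ^ n := by
    calc _ ≤ ((1 + x ^ 2 / n) ^ ((n:ℝ) / 3)) ^ 3 := by gcongr
      _ = _ := by
        rw [← Real.rpow_natCast _ 3, ← Real.rpow_mul (by positivity), ← Real.rpow_natCast _ n]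
        congr 1
        push_cast
        ring
  have h3 : (1 + x ^ 2 / 3) ^ 3 ≤ (1 + x ^ 2 / n) ^ (n + 1) :=
    h2.trans (pow_le_pow_right₀ (by linarith) (by omega))
  calc _ ≤ x ^ 4 * ((1 + x ^ 2 / 3) ^ 3)⁻¹ := by
        rw [inv_pow]; gcongr
    _ ≤ _ := by
      rw [← div_eq_mul_inv, ← div_eq_mul_inv, div_le_div_iff₀ (by positivity) (by positivity)]
      have : 0 ≤ x ^ 2 := by positivity
      nlinarith [pow_nonneg this 2, pow_nonneg this 3]

lemma qq_lim (c : ℝ) :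
    Tendsto (fun n : ℕ => (n : ℝ) ^ ((5 : ℝ) / 2) * qq c n) atTop
      (nhds (3 * √Real.pi / 4)) := by
  rw [← gauss4, ← tendsto_add_atTop_iff_nat 3]
  have := MeasureTheory.tendsto_integral_of_dominated_convergence (μ := MeasureTheory.volume)
    (F := fun (m : ℕ) (x : ℝ) => x ^ 4 / (1 + c ^ 2 * (x ^ 2 / ((m + 3 : ℕ) : ℝ))) ^ 2 *
      ((1 + x ^ 2 / ((m + 3 : ℕ) : ℝ))⁻¹) ^ (m + 3 + 1))
    (f := fun x : ℝ => x ^ 4 * Real.exp (-x ^ 2)) (fun x => 27 * (1 + x ^ 2)⁻¹)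
    (fun m => Measurable.aestronglyMeasurable (by fun_prop))
    (integrable_inv_one_add_sq.const_mul _) ?_ ?_
  · refine this.congr fun m => ?_
    rw [← scaled c (m + 3) (by omega)]
  · intro m
    refine Eventually.of_forall fun x => ?_
    rw [Real.norm_of_nonneg (by positivity)]
    refine le_trans ?_ (dom x (m + 3) (by omega))
    gcongr
    apply div_le_self (by positivity)
    apply one_le_pow₀
    have : 0 ≤ c ^ 2 * (x ^ 2 / ((m + 3 : ℕ) : ℝ)) := by positivity
    linarith
  · refine Eventually.of_forall fun x => ?_
    refine (tendsto_add_atTop_iff_nat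
      (f := fun n : ℕ => x ^ 4 / (1 + c ^ 2 * (x ^ 2 / (n : ℝ))) ^ 2 *
      ((1 + x ^ 2 / (n : ℝ))⁻¹) ^ (n + 1)) 3).2 ?_
    have t0 : Tendsto (fun n : ℕ => x ^ 2 / (n : ℝ)) atTop (nhds 0) :=
      tendsto_const_div_atTop_nhds_zero_nat _
    have t1 := Real.tendsto_one_add_div_pow_exp (x ^ 2)
    have t2 := (t1.mul (t0.const_add 1)).inv₀ (by positivity)
    have t3 := ((tendsto_const_nhds (x := x ^ 4)).div (((t0.const_mul (c ^ 2)).const_add 1).pow 2)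
      (by norm_num)).mul t2
    convert! t3 using 2
    · rw [inv_pow, pow_succ (1 + x ^ 2 / _), Pi.div_apply]
    · simp [Real.exp_neg]

noncomputable def coef (c : ℝ) (k : ℕ) : ℝ :=
  (if k = 0 then 1 - 1 / c ^ 2 else 0) + 2 * c / Real.pi * qq c k

lemma coef_hasSum (c : ℝ) (hc : 0 < c) (z : ℝ) (hz : |z| < 1) (hcz : c * √(1 - z) ≠ 1) :
    HasSum (fun k => coef c k * z ^ k) (1 - (1 - z) / (1 + c * √(1 - z)) ^ 2) := by
  have hz' := abs_lt.1 hz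
  have h1 := qq_hasSum c hc z hz
  have hw : 0 < √(1 - z) := Real.sqrt_pos.2 (by linarith)
  have h2 := int_eval c (√(1 - z)) hc hw hcz
  rw [Real.sq_sqrt (by linarith)] at h2
  rw [h2] at h1
  have h3 := (hasSum_ite_eq (0 : ℕ) (1 - 1 / c ^ 2)).add (h1.mul_left (2 * c / Real.pi))
  convert! h3 using 1
  · ext k
    rw [coef]
    split_ifs with hk
    · subst hk; simp
    · ring
  · have := Real.pi_pos
    have : 1 + c * √(1 - z) ≠ 0 := by positivity
    field_simp
    ring

lemma coef_bound (c : ℝ) (hc : 0 < c) (k : ℕ) :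
    |coef c k| ≤ |1 - 1 / c ^ 2| + 2 * c / Real.pi * qq c 0 := by
  have hp := Real.pi_pos
  rw [coef]
  refine (abs_add_le _ _).trans (add_le_add ?_ ?_)
  · split_ifs <;> simp
  · rw [abs_of_nonneg (mul_nonneg (by positivity) (qq_nonneg c k))]
    exact mul_le_mul_of_nonneg_left (qq_le c hc k) (by positivity)

lemma taylor (y : ℝ) (hy : 0 < y) (k : ℕ) :
    iteratedDeriv k (fun z : ℂ => 1 - 6 * (1 - z) /
      ((y : ℂ) * (1 - z) ^ ((1 : ℂ) / 2) + ((Real.sqrt 6 : ℝ) : ℂ)) ^ 2) 0 /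
          (Nat.factorial k : ℂ) = (coef (y / √6) k : ℂ) := by
  set f : ℂ → ℂ := fun z : ℂ => 1 - 6 * (1 - z) /
      ((y : ℂ) * (1 - z) ^ ((1 : ℂ) / 2) + ((Real.sqrt 6 : ℝ) : ℂ)) ^ 2 with hf
  have h6 : 0 < √(6:ℝ) := by positivity
  set c := y / √6 with hc_def
  have hc : 0 < c := by positivity
  have fa : AnalyticAt ℂ f 0 := by
    have a1 : AnalyticAt ℂ (fun z : ℂ => (1 - z) ^ ((1 : ℂ) / 2)) 0 :=
      AnalyticAt.cpow (by fun_prop) (by fun_prop) (by simp)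
    refine AnalyticAt.sub (by fun_prop) (AnalyticAt.div (by fun_prop)
      (((analyticAt_const.mul a1).add analyticAt_const).pow 2) ?_)
    simp only [sub_zero, Complex.one_cpow, mul_one]
    have : y + √6 ≠ 0 := by positivity
    exact pow_ne_zero 2 (by exact_mod_cast this)
  set p := FormalMultilinearSeries.ofScalars ℂ (fun k => (coef c k : ℂ)) with hp
  have hr : ((1 : NNReal) : ENNReal) ≤ p.radius := by
    refine p.le_radius_of_bound (|1 - 1 / c ^ 2| + 2 * c / Real.pi * qq c 0) fun n => ?_
    rw [hp, FormalMultilinearSeries.ofScalars_norm]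
    simpa using coef_bound c hc n
  have hps : HasFPowerSeriesOnBall p.sum p 0 p.radius :=
    p.hasFPowerSeriesOnBall (lt_of_lt_of_le (by simp) hr)
  have hpa := hps.hasFPowerSeriesAt
  have ev : ∀ᶠ z in nhds (0 : ℂ), f z = p.sum z := by
    refine (fa.frequently_eq_iff_eventually_eq hpa.analyticAt).1 ?_
    have ht : Tendsto (fun x : ℝ => (x : ℂ)) (nhdsWithin 0 (Set.Ioi 0)) (nhdsWithin 0 {0}ᶜ) := by
      refine tendsto_nhdsWithin_iff.2 ⟨?_, ?_⟩
      · exact ((Complex.continuous_ofReal.tendsto' 0 0 (by simp)).mono_left nhdsWithin_le_nhds)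
      · filter_upwards [self_mem_nhdsWithin] with x hx
        simpa using (ne_of_gt hx)
    refine ht.frequently (Eventually.frequently ?_)
    have m1 : ∀ᶠ x : ℝ in nhdsWithin 0 (Set.Ioi 0), x < 1 :=
      nhdsWithin_le_nhds (Iio_mem_nhds one_pos)
    have m2 : ∀ᶠ x : ℝ in nhdsWithin 0 (Set.Ioi 0), x ≠ 1 - 1 / c ^ 2 := by
      by_cases h : 1 - 1 / c ^ 2 = 0
      · filter_upwards [self_mem_nhdsWithin] with x hx
        rw [h]; exact ne_of_gt hx
      · exact nhdsWithin_le_nhds (isOpen_ne.mem_nhds (Ne.symm h))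
    filter_upwards [self_mem_nhdsWithin, m1, m2] with x hx0 hx1 hx2
    have hx0' : 0 < x := hx0
    have hne : c * √(1 - x) ≠ 1 := by
      intro h
      apply hx2
      have h' : c ^ 2 * (1 - x) = 1 := by
        rw [← Real.sq_sqrt (show 0 ≤ 1 - x by linarith), ← mul_pow, h, one_pow]
      field_simp
      linarith
    have hs := coef_hasSum c hc x (by rw [abs_of_pos hx0']; exact hx1) hne
    have hs' : HasSum (fun k => (coef c k : ℂ) * (x : ℂ) ^ k)
        ((1 - (1 - x) / (1 + c * √(1 - x)) ^ 2 : ℝ) : ℂ) := by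
      exact_mod_cast (Complex.hasSum_ofReal.2 hs)
    have e1 : p.sum (x : ℂ) = ∑' k, (coef c k : ℂ) * (x : ℂ) ^ k := by
      have := FormalMultilinearSeries.ofScalars_sum_eq (E := ℂ) (fun k => (coef c k : ℂ)) (x : ℂ)
      simpa [FormalMultilinearSeries.ofScalarsSum] using this
    rw [e1, hs'.tsum_eq, hf]
    have e2 : (1 - (x : ℂ)) ^ ((1 : ℂ) / 2) = (√(1 - x) : ℂ) := by
      rw [Real.sqrt_eq_rpow, Complex.ofReal_cpow (by linarith)]
      push_cast
      rfl
    simp only [e2]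
    norm_cast
    congr 1
    rw [hc_def]
    have h66 : √(6:ℝ) ^ 2 = 6 := Real.sq_sqrt (by norm_num)
    have hd : y * √(1 - x) + √6 ≠ 0 := by positivity
    have e3 : 1 + y / √6 * √(1 - x) = (y * √(1 - x) + √6) / √6 := by
      field_simp
      ring
    rw [e3, div_pow, h66]
    field_simp
  have hfp : HasFPowerSeriesAt f p 0 := hpa.congr (ev.mono fun z hz => hz.symm)
  have := (fa.hasFPowerSeriesAt).eq_formalMultilinearSeries hfp
  have := FormalMultilinearSeries.ofScalars_series_injective ℂ ℂ this
  exact congrFun this k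

/-- Local limit asymptotics for the number of killed particles in the Moranian case:
the Taylor coefficients `p_k` of `φ(s) = 1 − 6(1−s)/(y√(1−s) + √6)²` at `0` satisfy
`k^{5/2} p_k → 3y/(2√(6π))`. -/
theorem killed_local_asymptotics (y : ℝ) (hy : 0 < y) :
    Tendsto
      (fun k : ℕ => (((k : ℝ) ^ ((5 : ℝ) / 2) : ℝ) : ℂ) *
        (iteratedDeriv k
            (fun z : ℂ => 1 - 6 * (1 - z) /
              ((y : ℂ) * (1 - z) ^ ((1 : ℂ) / 2) + ((Real.sqrt 6 : ℝ) : ℂ)) ^ 2) 0 /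
          (Nat.factorial k : ℂ)))
      atTop (nhds (((3 * y / (2 * Real.sqrt (6 * Real.pi)) : ℝ) : ℂ))) := by
  simp only [taylor y hy]
  have h := (qq_lim (y / √6)).const_mul (2 * (y / √6) / Real.pi)
  have e : 2 * (y / √6) / Real.pi * (3 * √Real.pi / 4) =
      3 * y / (2 * Real.sqrt (6 * Real.pi)) := by
    rw [Real.sqrt_mul (by norm_num)]
    have hp := Real.pi_pos
    have hs : 0 < √Real.pi := Real.sqrt_pos.2 hp
    have h2 : √Real.pi ^ 2 = Real.pi := Real.sq_sqrt hp.le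
    have h6 : 0 < √(6:ℝ) := by positivity
    field_simp
    rw [h2]
    ring
  rw [e] at h
  have h' := (Complex.continuous_ofReal.tendsto _).comp h
  refine h'.congr' ?_
  filter_upwards [eventually_gt_atTop 0] with k hk
  simp only [Function.comp, coef, if_neg hk.ne']
  push_cast
  ring
end
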